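/- Let n ≥ 4 be even and let u ∈ C^∞(ℝⁿ). Set f := (−Δ)^{n/2} u. Assume the metric e^{2u}|dx|² is complete, ∫_{ℝⁿ}|f(x)| dx < ∞, the metric is normal (u(x) = (1/(2c_n)) ∫_{ℝⁿ} log(|y|/|x−y|) f(y) dy + C for some constant C), and (1/(2c_n)) ∫_{ℝⁿ} f(x) dx < 1. Then there exist H ≥ 1, an H-quasiconformal orientation-preserving homeomorphism F : ℝⁿ → ℝⁿ, and a constant C₁ ≥ 1 such that F is differentiable at almost every x ∈ ℝⁿ with C₁^{−1} e^{nu(x)} ≤ |det DF(x)| ≤ C₁ e^{nu(x)} for almost every x. -/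

import Mathlib

open MeasureTheory Metric Filter Set

noncomputable section

/-- Euclidean space `ℝⁿ`. -/
abbrev Eu (n : ℕ) := EuclideanSpace ℝ (Fin n)

/-- The Euclidean Laplacian `Δu(x) = ∑ᵢ ∂²u/∂xᵢ²`. -/
def lap {n : ℕ} (u : Eu n → ℝ) (x : Eu n) : ℝ :=
  ∑ i : Fin n, iteratedFDeriv ℝ 2 u x ![EuclideanSpace.single i 1, EuclideanSpace.single i 1]

/-- Iterated Laplacian `Δᵏ`. -/
def lapIter {n : ℕ} : ℕ → (Eu n → ℝ) → Eu n → ℝ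
  | 0, u => u
  | k + 1, u => lap (lapIter k u)

/-- The constant `c_n = 2^(n-2) ((n-2)/2)! π^(n/2)`. -/
def cQ (n : ℕ) : ℝ := 2 ^ (n - 2) * (Nat.factorial ((n - 2) / 2)) * Real.pi ^ (n / 2)

/-- A path `γ : [0,1] → ℝⁿ` which is continuous and differentiable away from
finitely many points (piecewise C¹). -/
def PiecewiseC1 {n : ℕ} (γ : ℝ → Eu n) : Prop :=
  ContinuousOn γ (Set.Icc 0 1) ∧
    ∃ S : Finset ℝ, ∀ t ∈ Set.Icc (0 : ℝ) 1, t ∉ S → DifferentiableAt ℝ γ t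

/-- Length of the path `γ` in the conformal metric `e^{2u}|dx|²`. -/
def confLength {n : ℕ} (u : Eu n → ℝ) (γ : ℝ → Eu n) : ℝ :=
  ∫ t in (0 : ℝ)..1, Real.exp (u (γ t)) * ‖deriv γ t‖

/-- The distance `d_u` induced by the conformal metric `e^{2u}|dx|²`. -/
def confDist {n : ℕ} (u : Eu n → ℝ) (x y : Eu n) : ℝ :=
  sInf { L | ∃ γ : ℝ → Eu n, γ 0 = x ∧ γ 1 = y ∧ PiecewiseC1 γ ∧ L = confLength u γ }

/-- Completeness of the conformal metric `e^{2u}|dx|²`: every sequence which is Cauchy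
for `d_u` converges for `d_u`. -/
def ConfComplete {n : ℕ} (u : Eu n → ℝ) : Prop :=
  ∀ s : ℕ → Eu n,
    (∀ ε : ℝ, 0 < ε → ∃ N : ℕ, ∀ m ≥ N, ∀ l ≥ N, confDist u (s m) (s l) < ε) →
      ∃ x : Eu n, ∀ ε : ℝ, 0 < ε → ∃ N : ℕ, ∀ m ≥ N, confDist u (s m) x < ε

/-- The ratio `(sup_{|a-x|=r} |F a - F x|) / (inf_{|b-x|=r} |F b - F x|)`. -/
def dilatQuot {n : ℕ} (F : Eu n → Eu n) (x : Eu n) (r : ℝ) : ℝ :=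
  sSup ((fun a => ‖F a - F x‖) '' sphere x r) / sInf ((fun b => ‖F b - F x‖) '' sphere x r)

/-- `F` is `H`-quasiconformal: at every point the limsup as `r → 0⁺` of the dilation
quotient is at most `H`. -/
def QuasiconformalWith {n : ℕ} (H : ℝ) (F : Eu n → Eu n) : Prop :=
  ∀ x : Eu n, Filter.limsup (fun r => dilatQuot F x r) (nhdsWithin 0 (Set.Ioi 0)) ≤ H

/-- The Jacobian determinant of `F` at `x`. -/
def jacDet {n : ℕ} (F : Eu n → Eu n) (x : Eu n) : ℝ :=
  LinearMap.det ((fderiv ℝ F x) : Eu n →ₗ[ℝ] Eu n)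

set_option linter.unusedSectionVars false

section Kernel

variable {E : Type*} [NormedAddCommGroup E]

/-- The distance from `x` to `y`, measured in units of `2 ^ (-(k + 1)) ‖y‖`. -/
def relDist (k : ℕ) (x y : E) : ℝ := 2 ^ (k + 1) * ‖x - y‖ / ‖y‖

/-- A `C¹` cutoff function of `x` living on the ball `relDist k x y < 1`. -/
def bump (k : ℕ) (x y : E) : ℝ := (max (1 - relDist k x y ^ 2) 0) ^ 2

/-- The truncated relative distance, controlling the size of the derivative of `bump`. -/
def truncDist (k : ℕ) (x y : E) : ℝ := if relDist k x y < 1 then relDist k x y else 0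

lemma relDist_nonneg (k : ℕ) (x y : E) : 0 ≤ relDist k x y := by
  unfold relDist; positivity

lemma truncDist_nonneg (k : ℕ) (x y : E) : 0 ≤ truncDist k x y := by
  unfold truncDist
  split_ifs
  · exact relDist_nonneg k x y
  · exact le_rfl

lemma truncDist_le_one (k : ℕ) (x y : E) : truncDist k x y ≤ 1 := by
  unfold truncDist
  split_ifs with h
  · exact h.le
  · exact zero_le_one

lemma bump_nonneg (k : ℕ) (x y : E) : 0 ≤ bump k x y := sq_nonneg _

lemma bump_le_one (k : ℕ) (x y : E) : bump k x y ≤ 1 := by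
  have h : max (1 - relDist k x y ^ 2) 0 ≤ 1 := max_le (by nlinarith [sq_nonneg (relDist k x y)])
    zero_le_one
  exact pow_le_one₀ (le_max_right _ _) h

lemma abs_bump_le_one (k : ℕ) (x y : E) : |bump k x y| ≤ 1 := by
  rw [abs_of_nonneg (bump_nonneg k x y)]
  exact bump_le_one k x y

lemma bump_eq_zero {k : ℕ} {x y : E} (h : 1 ≤ relDist k x y) : bump k x y = 0 := by
  have : 1 - relDist k x y ^ 2 ≤ 0 := by nlinarith
  simp [bump, max_eq_right this]

lemma norm_sub_le_of_relDist {k : ℕ} {x y : E} (hy : y ≠ 0) (h : relDist k x y < 1) :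
    2 ^ (k + 1) * ‖x - y‖ ≤ ‖y‖ := by
  have hy' : 0 < ‖y‖ := norm_pos_iff.2 hy
  rw [relDist, div_lt_one hy'] at h
  exact h.le

lemma two_mul_norm_sub_le_of_relDist {k : ℕ} {x y : E} (hy : y ≠ 0) (h : relDist k x y < 1) :
    2 * ‖x - y‖ ≤ ‖y‖ := by
  refine le_trans ?_ (norm_sub_le_of_relDist hy h)
  have : (2 : ℝ) ≤ 2 ^ (k + 1) := by
    rw [pow_succ]
    nlinarith [one_le_pow₀ (n := k) (one_le_two (α := ℝ))]
  gcongr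

lemma norm_le_two_mul_of_relDist {k : ℕ} {x y : E} (hy : y ≠ 0) (h : relDist k x y < 1) :
    ‖y‖ ≤ 2 * ‖x‖ := by
  have h1 := two_mul_norm_sub_le_of_relDist hy h
  have h2 : ‖y‖ ≤ ‖x‖ + ‖x - y‖ := by
    rw [norm_sub_rev]; exact norm_le_norm_add_norm_sub' y x
  linarith

lemma norm_le_of_relDist {k : ℕ} {x y : E} (hy : y ≠ 0) (h : relDist k x y < 1) :
    ‖x‖ ≤ 3 / 2 * ‖y‖ := by
  have h1 := two_mul_norm_sub_le_of_relDist hy h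
  have h2 : ‖x‖ ≤ ‖y‖ + ‖x - y‖ := norm_le_norm_add_norm_sub' x y
  linarith

lemma sum_truncDist_le (x y : E) (N : ℕ) : ∑ k ∈ Finset.range N, truncDist k x y ≤ 2 := by
  set t := ‖x - y‖ / ‖y‖ with ht
  have ht0 : 0 ≤ t := by positivity
  have key : ∀ N : ℕ, ∑ k ∈ Finset.range N, truncDist k x y ≤ 2 ∧
      ∑ k ∈ Finset.range N, truncDist k x y ≤ 2 ^ (N + 1) * t := by
    intro N
    induction N with
    | zero => simp; positivity
    | succ N ih =>
      have hrel : relDist N x y = 2 ^ (N + 1) * t := by rw [relDist, ht, mul_div_assoc]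
      rw [Finset.sum_range_succ, truncDist, hrel]
      have hp : (2 : ℝ) ^ (N + 1 + 1) * t = 2 * (2 ^ (N + 1) * t) := by ring
      have hp0 : 0 ≤ (2 : ℝ) ^ (N + 1) * t := by positivity
      rw [hp]
      split_ifs with h
      · constructor <;> linarith [ih.2]
      · constructor <;> linarith [ih.1, ih.2]
  exact (key N).1

/-- The sum over all scales of `bump` is a logarithm, up to a bounded error. -/
lemma exists_bump_sum (x y : E) (hxy : x ≠ y) (hy : y ≠ 0) :
    ∃ K : ℕ, (∀ k, K ≤ k → bump k x y = 0) ∧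
      |Real.log 2 * ∑ k ∈ Finset.range K, bump k x y - max (Real.log (‖y‖ / ‖x - y‖)) 0| ≤ 4 := by
  have hy' : 0 < ‖y‖ := norm_pos_iff.2 hy
  have hxy' : 0 < ‖x - y‖ := norm_pos_iff.2 (sub_ne_zero.2 hxy)
  set t := ‖x - y‖ / ‖y‖ with ht
  have ht0 : 0 < t := by positivity
  have hinv : ‖y‖ / ‖x - y‖ = 1 / t := by rw [ht, one_div_div]
  have hrel : ∀ k, relDist k x y = 2 ^ (k + 1) * t := fun k => by rw [relDist, ht, mul_div_assoc]
  have hl2 : Real.log 2 ≤ 1 := by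
    have := Real.log_two_lt_d9; linarith
  have hl20 : 0 < Real.log 2 := Real.log_pos one_lt_two
  rw [hinv]
  rcases le_or_gt 1 t with h1 | h1
  · refine ⟨0, fun k _ => bump_eq_zero ?_, ?_⟩
    · rw [hrel]
      have : (1 : ℝ) ≤ 2 ^ (k + 1) := one_le_pow₀ one_le_two
      nlinarith
    · have : Real.log (1 / t) ≤ 0 :=
        Real.log_nonpos (by positivity) ((div_le_one ht0).2 h1)
      simp only [Finset.range_zero, Finset.sum_empty, mul_zero, max_eq_right this, sub_zero,
        abs_zero]
      norm_num
  · obtain ⟨K, hK1, hK2⟩ := exists_nat_pow_near (x := 1 / t) (y := (2 : ℝ))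
      ((one_le_div ht0).2 h1.le) one_lt_two
    rw [le_div_iff₀ ht0] at hK1
    rw [div_lt_iff₀ ht0] at hK2
    refine ⟨K, fun k hk => bump_eq_zero ?_, ?_⟩
    · rw [hrel]
      have : (2 : ℝ) ^ (K + 1) ≤ 2 ^ (k + 1) := pow_le_pow_right₀ one_le_two (by omega)
      nlinarith
    · have hup : ∑ k ∈ Finset.range K, bump k x y ≤ K := by
        calc _ ≤ ∑ k ∈ Finset.range K, (1 : ℝ) := Finset.sum_le_sum fun k _ => bump_le_one k x y
          _ = K := by simp
      have hgeo : ∀ M : ℕ, ∑ k ∈ Finset.range M, 2 * ((2 : ℝ) ^ (k + 1) * t) ^ 2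
          ≤ 8 / 3 * (2 ^ M * t) ^ 2 := by
        intro M
        induction M with
        | zero => simp; positivity
        | succ M ih =>
          rw [Finset.sum_range_succ]
          have : (8 : ℝ) / 3 * (2 ^ (M + 1) * t) ^ 2 = 32 / 3 * (2 ^ M * t) ^ 2 := by ring
          have h' : (2 : ℝ) * (2 ^ (M + 1) * t) ^ 2 = 8 * (2 ^ M * t) ^ 2 := by ring
          linarith [sq_nonneg ((2 : ℝ) ^ M * t)]
      have hlow : (K : ℝ) - 8 / 3 ≤ ∑ k ∈ Finset.range K, bump k x y := by
        have h1 : ∀ k, 1 - 2 * ((2 : ℝ) ^ (k + 1) * t) ^ 2 ≤ bump k x y := by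
          intro k
          rw [bump, hrel]
          set q := ((2 : ℝ) ^ (k + 1) * t) ^ 2
          have hq : 0 ≤ q := sq_nonneg _
          rcases le_total q 1 with h | h
          · rw [max_eq_left (by linarith)]; nlinarith
          · rw [max_eq_right (by linarith)]; nlinarith
        have h2 : (∑ k ∈ Finset.range K, (1 - 2 * ((2 : ℝ) ^ (k + 1) * t) ^ 2)) ≤
            ∑ k ∈ Finset.range K, bump k x y := Finset.sum_le_sum fun k _ => h1 k
        rw [Finset.sum_sub_distrib] at h2
        have h3 := hgeo K
        have h4 : (2 ^ K * t) ^ 2 ≤ 1 := pow_le_one₀ (by positivity) hK1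
        simp only [Finset.sum_const, Finset.card_range, nsmul_eq_mul, mul_one] at h2
        linarith
      have hL1 : K * Real.log 2 ≤ Real.log (1 / t) := by
        rw [← Real.log_pow]
        exact Real.log_le_log (by positivity) ((le_div_iff₀ ht0).2 hK1)
      have hL2 : Real.log (1 / t) ≤ (K + 1) * Real.log 2 := by
        have : ((K : ℝ) + 1) * Real.log 2 = Real.log (2 ^ (K + 1)) := by
          rw [Real.log_pow]; push_cast; ring
        rw [this]
        exact Real.log_le_log (by positivity) ((div_le_iff₀ ht0).2 hK2.le)
      have h0 : 0 ≤ Real.log (1 / t) := le_trans (by positivity) hL1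
      rw [max_eq_left h0, abs_le]
      constructor <;> nlinarith

end Kernel

section KernelDeriv

variable {E : Type*} [NormedAddCommGroup E] [InnerProductSpace ℝ E]

lemma hasDerivAt_max_zero_sq (s : ℝ) :
    HasDerivAt (fun s : ℝ => (max s 0) ^ 2) (2 * max s 0) s := by
  rcases lt_trichotomy s 0 with h | h | h
  · rw [max_eq_right h.le, mul_zero]
    refine (hasDerivAt_const s (0 : ℝ)).congr_of_eventuallyEq ?_
    filter_upwards [Iio_mem_nhds h] with z hz
    simp [max_eq_right (le_of_lt (mem_Iio.1 hz))]
  · subst h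
    rw [max_self, mul_zero, hasDerivAt_iff_isLittleO]
    have h1 : (fun z : ℝ => z ^ 2) =o[nhds 0] fun z => z := by
      simpa using (Asymptotics.isLittleO_pow_pow (𝕜 := ℝ) (m := 1) (n := 2) (by norm_num))
    refine Asymptotics.IsBigO.trans_isLittleO (Asymptotics.IsBigO.of_bound 1 ?_)
      (by simpa using h1)
    filter_upwards with z
    simp only [max_self, smul_zero, sub_zero, one_mul, Real.norm_eq_abs, abs_pow,
      ne_eq, OfNat.ofNat_ne_zero, not_false_eq_true, zero_pow]
    rw [abs_of_nonneg (le_max_right z 0)]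
    exact pow_le_pow_left₀ (le_max_right z 0) (max_le (le_abs_self z) (abs_nonneg z)) 2
  · rw [max_eq_left h.le]
    have : HasDerivAt (fun s : ℝ => s ^ 2) (2 * s) s := by simpa using hasDerivAt_pow 2 s
    refine this.congr_of_eventuallyEq ?_
    filter_upwards [Ioi_mem_nhds h] with z hz
    simp [max_eq_left (le_of_lt (mem_Ioi.1 hz))]

/-- The derivative of `bump k x y` with respect to `x`. -/
def bumpDeriv (k : ℕ) (x y : E) : E →L[ℝ] ℝ :=
  (-(4 * max (1 - relDist k x y ^ 2) 0 * (2 ^ (k + 1) / ‖y‖) ^ 2)) • innerSL ℝ (x - y)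

lemma hasFDerivAt_bump (k : ℕ) (x y : E) :
    HasFDerivAt (fun x => bump k x y) (bumpDeriv k x y) x := by
  have h1 : HasFDerivAt (fun x : E => ‖x - y‖ ^ 2) (2 • innerSL ℝ (x - y)) x := by
    simpa using ((hasFDerivAt_id x).sub_const y).norm_sq
  have h2 : HasFDerivAt (fun x : E => 1 - relDist k x y ^ 2)
      (-((2 ^ (k + 1) / ‖y‖) ^ 2 • (2 • innerSL ℝ (x - y)))) x := by
    have := (h1.const_mul ((2 ^ (k + 1) / ‖y‖) ^ 2)).const_sub 1
    refine this.congr_of_eventuallyEq (Eventually.of_forall fun z => ?_)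
    simp only [relDist]
    ring
  have h3 := (hasDerivAt_max_zero_sq (1 - relDist k x y ^ 2)).comp_hasFDerivAt x h2
  refine h3.congr_fderiv ?_
  ext v
  simp [bumpDeriv]
  ring

lemma norm_bumpDeriv_le (k : ℕ) (x : E) {y : E} (hy : y ≠ 0) :
    ‖bumpDeriv k x y‖ ≤ 4 * 2 ^ (k + 1) * truncDist k x y / ‖y‖ := by
  have hy' : 0 < ‖y‖ := norm_pos_iff.2 hy
  rw [bumpDeriv, norm_smul, innerSL_apply_norm, norm_neg, Real.norm_eq_abs, abs_of_nonneg (by positivity),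
    truncDist]
  split_ifs with h
  · have hm : max (1 - relDist k x y ^ 2) 0 ≤ 1 :=
      max_le (by nlinarith [sq_nonneg (relDist k x y)]) zero_le_one
    have : 4 * 2 ^ (k + 1) * relDist k x y / ‖y‖ = 4 * 1 * (2 ^ (k + 1) / ‖y‖) ^ 2 * ‖x - y‖ := by
      rw [relDist]; field_simp
    rw [this]
    gcongr
  · have : 1 - relDist k x y ^ 2 ≤ 0 := by nlinarith [not_lt.1 h]
    simp [max_eq_right this]

lemma bumpDeriv_eq_zero {k : ℕ} {x y : E} (h : 1 ≤ relDist k x y) : bumpDeriv k x y = 0 := by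
  have : 1 - relDist k x y ^ 2 ≤ 0 := by nlinarith
  simp [bumpDeriv, max_eq_right this]

lemma norm_mul_norm_bumpDeriv_le (k : ℕ) (x : E) {y : E} (hy : y ≠ 0) :
    ‖x‖ * ‖bumpDeriv k x y‖ ≤ 6 * 2 ^ (k + 1) * truncDist k x y := by
  have hy' : 0 < ‖y‖ := norm_pos_iff.2 hy
  by_cases h : relDist k x y < 1
  · have h1 := norm_le_of_relDist hy h
    have h2 := norm_bumpDeriv_le k x hy
    have h0 := truncDist_nonneg k x y
    calc ‖x‖ * ‖bumpDeriv k x y‖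
        ≤ (3 / 2 * ‖y‖) * (4 * 2 ^ (k + 1) * truncDist k x y / ‖y‖) := by gcongr
      _ = 6 * 2 ^ (k + 1) * truncDist k x y := by field_simp; ring
  · simp [bumpDeriv_eq_zero (not_lt.1 h), truncDist, h]

end KernelDeriv

section CutIntegral

variable {E : Type*} [NormedAddCommGroup E] [InnerProductSpace ℝ E] [FiniteDimensional ℝ E]
  [MeasurableSpace E] [BorelSpace E]
  {W : Type*} [NormedAddCommGroup W] [NormedSpace ℝ W]

/-- An integrable, locally bounded density which vanishes on the unit ball. -/
structure IsTailDensity (μ : Measure E) (ρ : E → ℝ) : Prop where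
  integrable : Integrable ρ μ
  eq_zero : ∀ y, ‖y‖ ≤ 1 → ρ y = 0
  locallyBounded : ∀ r : ℝ, ∃ M : ℝ, ∀ y, ‖y‖ ≤ r → |ρ y| ≤ M

/-- The integral of `h` against the density `ρ`, localized near `x` at scale `k`. -/
def cutInt (μ : Measure E) (ρ : E → ℝ) (k : ℕ) (h : E → W) (x : E) : W :=
  ∫ y, (bump k x y * ρ y) • h y ∂μ

/-- The derivative of `cutInt`. -/
def cutIntDeriv (μ : Measure E) (ρ : E → ℝ) (k : ℕ) (h : E → W) (x : E) : E →L[ℝ] W :=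
  ∫ y, ρ y • (bumpDeriv k x y).smulRight (h y) ∂μ

/-- The integral of `truncDist` against the density `|ρ|`. -/
def truncMass (μ : Measure E) (ρ : E → ℝ) (k : ℕ) (x : E) : ℝ :=
  ∫ y, truncDist k x y * |ρ y| ∂μ

variable {μ : Measure E} {ρ : E → ℝ}

lemma measurable_relDist (k : ℕ) (x : E) : Measurable fun y => relDist k x y := by
  unfold relDist; fun_prop

lemma measurable_bump (k : ℕ) (x : E) : Measurable fun y => bump k x y := by
  have := measurable_relDist k x
  unfold bump; fun_prop

lemma measurable_truncDist (k : ℕ) (x : E) : Measurable fun y => truncDist k x y :=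
  Measurable.ite (measurableSet_lt (measurable_relDist k x) measurable_const)
    (measurable_relDist k x) measurable_const

lemma aestronglyMeasurable_bumpDeriv (k : ℕ) (x : E) :
    AEStronglyMeasurable (fun y => bumpDeriv k x y) μ := by
  have h1 : Measurable fun y : E =>
      -(4 * max (1 - relDist k x y ^ 2) 0 * (2 ^ (k + 1) / ‖y‖) ^ 2) := by
    have := measurable_relDist k x
    fun_prop
  have h2 : Continuous fun y : E => innerSL ℝ (x - y) := by fun_prop
  exact h1.aestronglyMeasurable.smul h2.aestronglyMeasurable

lemma IsTailDensity.ne_zero (hρ : IsTailDensity μ ρ) {y : E} (hy : ρ y ≠ 0) : 1 ≤ ‖y‖ := by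
  by_contra h
  exact hy (hρ.eq_zero y (not_le.1 h).le)

lemma IsTailDensity.ne_zero' (hρ : IsTailDensity μ ρ) {y : E} (hy : ρ y ≠ 0) : y ≠ 0 :=
  norm_pos_iff.1 (lt_of_lt_of_le one_pos (hρ.ne_zero hy))

lemma IsTailDensity.integrable_truncDist (hρ : IsTailDensity μ ρ) (k : ℕ) (x : E) :
    Integrable (fun y => truncDist k x y * |ρ y|) μ := by
  refine hρ.integrable.abs.bdd_mul (c := 1) (measurable_truncDist k x).aestronglyMeasurable
    (Eventually.of_forall fun y => ?_)
  rw [Real.norm_eq_abs, abs_of_nonneg (truncDist_nonneg _ _ _)]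
  exact truncDist_le_one _ _ _

lemma truncMass_nonneg (k : ℕ) (x : E) : 0 ≤ truncMass μ ρ k x :=
  integral_nonneg fun _ => mul_nonneg (truncDist_nonneg _ _ _) (abs_nonneg _)

lemma IsTailDensity.truncMass_le (hρ : IsTailDensity μ ρ) (k : ℕ) (x : E) :
    truncMass μ ρ k x ≤ ∫ y, |ρ y| ∂μ :=
  integral_mono (hρ.integrable_truncDist k x) hρ.integrable.abs fun _ =>
    mul_le_of_le_one_left (abs_nonneg _) (truncDist_le_one _ _ _)

lemma IsTailDensity.sum_truncMass_le (hρ : IsTailDensity μ ρ) (x : E) (N : ℕ) :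
    ∑ k ∈ Finset.range N, truncMass μ ρ k x ≤ 2 * ∫ y, |ρ y| ∂μ := by
  unfold truncMass
  rw [← integral_finsetSum _ fun k _ => hρ.integrable_truncDist k x, ← integral_const_mul]
  refine integral_mono (integrable_finsetSum _ fun k _ => hρ.integrable_truncDist k x)
    (hρ.integrable.abs.const_mul 2) fun y => ?_
  simp only [← Finset.sum_mul]
  exact mul_le_mul_of_nonneg_right (sum_truncDist_le x y N) (abs_nonneg _)

/-- The bound on the derivative of the kernel of `cutInt`. -/
lemma IsTailDensity.norm_smul_bumpDeriv_le (hρ : IsTailDensity μ ρ) (k : ℕ) (x y : E) :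
    ‖ρ y • bumpDeriv k x y‖ ≤ 4 * 2 ^ (k + 1) * |ρ y| := by
  by_cases h0 : ρ y = 0
  · simp [h0]
  have hy := hρ.ne_zero h0
  rw [norm_smul, Real.norm_eq_abs, mul_comm]
  gcongr
  refine (norm_bumpDeriv_le k x (hρ.ne_zero' h0)).trans ?_
  refine (div_le_self (by have := truncDist_nonneg k x y; positivity) hy).trans ?_
  exact mul_le_of_le_one_right (by positivity) (truncDist_le_one _ _ _)

lemma relDist_support {k : ℕ} {x y : E} {r : ℝ} (hy : y ≠ 0) (hx : ‖x‖ ≤ r)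
    (hyr : 2 * r < ‖y‖) : 1 ≤ relDist k x y := by
  by_contra h
  have := norm_le_two_mul_of_relDist hy (not_le.1 h)
  linarith

lemma IsTailDensity.integrable_cut (hρ : IsTailDensity μ ρ) (k : ℕ) {h : E → W}
    (hh : Continuous h) (x : E) : Integrable (fun y => (bump k x y * ρ y) • h y) μ := by
  obtain ⟨M, hM⟩ := (isCompact_closedBall (0 : E) (2 * ‖x‖)).exists_bound_of_continuousOn
    hh.continuousOn
  refine (hρ.integrable.norm.mul_const M).mono'
    (((measurable_bump k x).aestronglyMeasurable.mul hρ.integrable.1).smul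
      hh.aestronglyMeasurable) (Eventually.of_forall fun y => ?_)
  by_cases h0 : ρ y = 0
  · simp [h0]
  rcases le_or_gt ‖y‖ (2 * ‖x‖) with hy | hy
  · have h1 := hM y (by simpa using hy)
    have h2 := abs_bump_le_one k x y
    rw [norm_smul, norm_mul, Real.norm_eq_abs, Real.norm_eq_abs]
    calc |bump k x y| * |ρ y| * ‖h y‖ ≤ 1 * |ρ y| * M := by gcongr
      _ = _ := by ring
  · have h3 := hM 0 (by simp)
    rw [bump_eq_zero (relDist_support (hρ.ne_zero' h0) le_rfl hy)]
    simp only [zero_mul, zero_smul, norm_zero]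
    exact mul_nonneg (norm_nonneg _) ((norm_nonneg _).trans h3)

lemma IsTailDensity.cutDeriv_bound (hρ : IsTailDensity μ ρ) (k : ℕ) {h : E → W} {r M : ℝ}
    (hr : 0 ≤ r) (hM : ∀ y ∈ closedBall (0 : E) (2 * r), ‖h y‖ ≤ M) {x : E} (hx : ‖x‖ ≤ r) (y : E) :
    ‖ρ y • (bumpDeriv k x y).smulRight (h y)‖ ≤ 4 * 2 ^ (k + 1) * |ρ y| * M := by
  by_cases h0 : ρ y = 0
  · simp [h0]
  have hM0 : 0 ≤ M := (norm_nonneg _).trans (hM 0 (by simp [hr]))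
  rcases le_or_gt ‖y‖ (2 * r) with hy | hy
  · have h1 := hM y (by simpa using hy)
    have h2 := hρ.norm_smul_bumpDeriv_le k x y
    rw [norm_smul] at h2 ⊢
    rw [ContinuousLinearMap.norm_smulRight_apply, ← mul_assoc]
    gcongr
  · rw [bumpDeriv_eq_zero (relDist_support (hρ.ne_zero' h0) hx hy)]
    simp only [ContinuousLinearMap.zero_smulRight, smul_zero, norm_zero]
    positivity

lemma IsTailDensity.aestronglyMeasurable_cutDeriv (hρ : IsTailDensity μ ρ) (k : ℕ) {h : E → W}
    (hh : Continuous h) (x : E) :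
    AEStronglyMeasurable (fun y => ρ y • (bumpDeriv k x y).smulRight (h y)) μ := by
  refine hρ.integrable.1.smul ?_
  exact ((ContinuousLinearMap.smulRightL ℝ E W).continuous₂).comp_aestronglyMeasurable₂
    (aestronglyMeasurable_bumpDeriv k x) hh.aestronglyMeasurable

lemma IsTailDensity.integrable_cutDeriv (hρ : IsTailDensity μ ρ) (k : ℕ) {h : E → W}
    (hh : Continuous h) (x : E) :
    Integrable (fun y => ρ y • (bumpDeriv k x y).smulRight (h y)) μ := by
  obtain ⟨M, hM⟩ := (isCompact_closedBall (0 : E) (2 * ‖x‖)).exists_bound_of_continuousOn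
    hh.continuousOn
  exact ((hρ.integrable.abs.const_mul (4 * 2 ^ (k + 1))).mul_const M).mono'
    (hρ.aestronglyMeasurable_cutDeriv k hh x)
    (Eventually.of_forall fun y => hρ.cutDeriv_bound k (norm_nonneg x) hM le_rfl y)

lemma IsTailDensity.hasFDerivAt_cutInt (hρ : IsTailDensity μ ρ) (k : ℕ) {h : E → W}
    (hh : Continuous h) (x : E) :
    HasFDerivAt (cutInt μ ρ k h) (cutIntDeriv μ ρ k h x) x := by
  obtain ⟨M, hM⟩ := (isCompact_closedBall (0 : E) (2 * (‖x‖ + 1))).exists_bound_of_continuousOn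
    hh.continuousOn
  have hint : Integrable (fun y => 4 * 2 ^ (k + 1) * |ρ y| * M) μ :=
    (hρ.integrable.abs.const_mul (4 * 2 ^ (k + 1))).mul_const M
  refine hasFDerivAt_integral_of_dominated_of_fderiv_le (ball_mem_nhds x one_pos)
    (F := fun x y => (bump k x y * ρ y) • h y)
    (F' := fun x y => ρ y • (bumpDeriv k x y).smulRight (h y))
    (Eventually.of_forall fun z => (hρ.integrable_cut k hh z).1) (hρ.integrable_cut k hh x)
    (hρ.integrable_cutDeriv k hh x).1 (Eventually.of_forall fun y z hz => ?_) hint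
    (Eventually.of_forall fun y z _ => ?_)
  · refine hρ.cutDeriv_bound k (by positivity) hM ?_ y
    have h1 : ‖z - x‖ < 1 := by simpa [dist_eq_norm] using hz
    have h2 := norm_le_norm_add_norm_sub' z x
    linarith
  · have := ((hasFDerivAt_bump k z y).mul_const (ρ y)).smul_const (h y)
    refine this.congr_fderiv ?_
    ext v
    simp [smul_smul]

/-- Total mass near `x` at scale `k`. -/
lemma IsTailDensity.abs_cutInt_one_le (hρ : IsTailDensity μ ρ) (k : ℕ) (x : E) :
    |cutInt μ ρ k (fun _ => (1 : ℝ)) x| ≤ ∫ y, |ρ y| ∂μ := by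
  unfold cutInt
  refine (norm_integral_le_integral_norm _).trans
    (integral_mono (hρ.integrable_cut k (continuous_const (y := (1 : ℝ))) x).norm hρ.integrable.abs fun y => ?_)
  simp only [smul_eq_mul, mul_one, norm_mul, Real.norm_eq_abs]
  exact mul_le_of_le_one_left (abs_nonneg _) (abs_bump_le_one k x y)

lemma IsTailDensity.norm_mul_norm_cutIntDeriv_one_le (hρ : IsTailDensity μ ρ) (k : ℕ) (x : E) :
    ‖x‖ * ‖cutIntDeriv μ ρ k (fun _ => (1 : ℝ)) x‖ ≤ 6 * 2 ^ (k + 1) * truncMass μ ρ k x := by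
  unfold cutIntDeriv truncMass
  rw [← integral_const_mul]
  refine (mul_le_mul_of_nonneg_left (norm_integral_le_integral_norm _) (norm_nonneg x)).trans ?_
  rw [← integral_const_mul]
  refine integral_mono ((hρ.integrable_cutDeriv k (continuous_const (y := (1 : ℝ))) x).norm.const_mul _)
    ((hρ.integrable_truncDist k x).const_mul _) fun y => ?_
  by_cases h0 : ρ y = 0
  · simp [h0]
  have h1 := norm_mul_norm_bumpDeriv_le k x (hρ.ne_zero' h0)
  simp only [norm_smul, ContinuousLinearMap.norm_smulRight_apply, norm_one, mul_one,
    Real.norm_eq_abs]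
  nlinarith [abs_nonneg (ρ y)]

variable [CompleteSpace W]

/-- The localized average displacement. -/
lemma IsTailDensity.norm_cutInt_sub_le (hρ : IsTailDensity μ ρ) (k : ℕ) {F : E → W}
    (hF : Continuous F) {x : E} {L : ℝ} (hL : 0 ≤ L)
    (hFL : ∀ y, y ≠ 0 → relDist k x y < 1 → ‖F x - F y‖ ≤ L * ‖x - y‖) :
    ‖cutInt μ ρ k (fun y => F x - F y) x‖ ≤ 2 * L * ‖x‖ / 2 ^ (k + 1) * truncMass μ ρ k x := by
  unfold cutInt truncMass
  rw [← integral_const_mul]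
  refine (norm_integral_le_integral_norm _).trans
    (integral_mono (hρ.integrable_cut k (continuous_const.sub hF) x).norm
      ((hρ.integrable_truncDist k x).const_mul _) fun y => ?_)
  by_cases h0 : ρ y = 0
  · simp [h0]
  have hy := hρ.ne_zero' h0
  have hy' : 0 < ‖y‖ := norm_pos_iff.2 hy
  simp only [norm_smul, norm_mul, Real.norm_eq_abs]
  by_cases h : relDist k x y < 1
  · have h1 := hFL y hy h
    have h2 := abs_bump_le_one k x y
    have h3 := norm_le_two_mul_of_relDist hy h
    have h4 : ‖x - y‖ ≤ 2 * ‖x‖ / 2 ^ (k + 1) * relDist k x y := by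
      have : 2 * ‖x‖ / 2 ^ (k + 1) * relDist k x y = 2 * ‖x‖ / ‖y‖ * ‖x - y‖ := by
        rw [relDist]; field_simp
      rw [this]
      exact le_mul_of_one_le_left (norm_nonneg _) ((one_le_div hy').2 h3)
    rw [truncDist, if_pos h]
    calc |bump k x y| * |ρ y| * ‖F x - F y‖
        ≤ 1 * |ρ y| * (L * (2 * ‖x‖ / 2 ^ (k + 1) * relDist k x y)) := by
          gcongr; exact h1.trans (by gcongr)
      _ = _ := by ring
  · simp [bump_eq_zero (not_lt.1 h), truncDist, h]

lemma IsTailDensity.norm_cutIntDeriv_sub_le (hρ : IsTailDensity μ ρ) (k : ℕ) {F : E → W}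
    (hF : Continuous F) {x : E} {L : ℝ} (hL : 0 ≤ L)
    (hFL : ∀ y, y ≠ 0 → relDist k x y < 1 → ‖F x - F y‖ ≤ L * ‖x - y‖) :
    ‖cutIntDeriv μ ρ k (fun y => F x - F y) x‖ ≤ 4 * L * truncMass μ ρ k x := by
  unfold cutIntDeriv truncMass
  rw [← integral_const_mul]
  refine (norm_integral_le_integral_norm _).trans
    (integral_mono (hρ.integrable_cutDeriv k (continuous_const.sub hF) x).norm
      ((hρ.integrable_truncDist k x).const_mul _) fun y => ?_)
  by_cases h0 : ρ y = 0
  · simp [h0]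
  have hy := hρ.ne_zero' h0
  have hy' : 0 < ‖y‖ := norm_pos_iff.2 hy
  simp only [norm_smul, ContinuousLinearMap.norm_smulRight_apply, Real.norm_eq_abs]
  by_cases h : relDist k x y < 1
  · have h1 := hFL y hy h
    have h2 := norm_bumpDeriv_le k x hy
    have h3 := truncDist_nonneg k x y
    have h4 : 2 ^ (k + 1) * ‖x - y‖ / ‖y‖ ≤ 1 := h.le
    calc |ρ y| * (‖bumpDeriv k x y‖ * ‖F x - F y‖)
        ≤ |ρ y| * ((4 * 2 ^ (k + 1) * truncDist k x y / ‖y‖) * (L * ‖x - y‖)) := by gcongr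
      _ = 4 * L * (truncDist k x y * |ρ y|) * (2 ^ (k + 1) * ‖x - y‖ / ‖y‖) := by field_simp
      _ ≤ 4 * L * (truncDist k x y * |ρ y|) := mul_le_of_le_one_right (by positivity) h4
  · simp [bumpDeriv_eq_zero (not_lt.1 h), truncDist, h]

lemma IsTailDensity.cutInt_sub (hρ : IsTailDensity μ ρ) (k : ℕ) {F : E → W}
    (hF : Continuous F) (x : E) (w : W) :
    cutInt μ ρ k (fun y => w - F y) x =
      cutInt μ ρ k (fun _ => (1 : ℝ)) x • w - cutInt μ ρ k F x := by
  unfold cutInt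
  have h1 := hρ.integrable_cut k (continuous_const (y := (1 : ℝ))) x
  rw [← integral_smul_const, ← integral_sub (h1.smul_const w) (hρ.integrable_cut k hF x)]
  simp [smul_sub]

lemma IsTailDensity.cutIntDeriv_sub (hρ : IsTailDensity μ ρ) (k : ℕ) {F : E → W}
    (hF : Continuous F) (x : E) (w : W) :
    cutIntDeriv μ ρ k (fun y => w - F y) x =
      (cutIntDeriv μ ρ k (fun _ => (1 : ℝ)) x).smulRight w - cutIntDeriv μ ρ k F x := by
  unfold cutIntDeriv
  have h1 := hρ.integrable_cutDeriv k (continuous_const (y := (1 : ℝ))) x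
  set T := (ContinuousLinearMap.smulRightL ℝ E W).flip w
  have hT : ∀ y, T (ρ y • (bumpDeriv k x y).smulRight (1 : ℝ)) =
      ρ y • (bumpDeriv k x y).smulRight w := fun y => by
    ext v
    simp [T]
  have h2 : ∫ y, ρ y • (bumpDeriv k x y).smulRight w ∂μ =
      (∫ y, ρ y • (bumpDeriv k x y).smulRight (1 : ℝ) ∂μ).smulRight w := by
    have h := T.integral_comp_comm h1
    simp only [hT] at h
    exact h
  have h3 : Integrable (fun y => ρ y • (bumpDeriv k x y).smulRight w) μ := by
    simpa only [hT] using T.integrable_comp h1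
  rw [← h2, ← integral_sub h3 (hρ.integrable_cutDeriv k hF x)]
  congr 1
  ext y v
  simp [smul_sub]

lemma IsTailDensity.hasFDerivAt_cutInt_sub (hρ : IsTailDensity μ ρ) (k : ℕ) {F : E → W}
    (hF : Differentiable ℝ F) (x : E) :
    HasFDerivAt (fun x => cutInt μ ρ k (fun y => F x - F y) x)
      (cutInt μ ρ k (fun _ => (1 : ℝ)) x • fderiv ℝ F x +
        cutIntDeriv μ ρ k (fun y => F x - F y) x) x := by
  simp only [hρ.cutInt_sub k hF.continuous, hρ.cutIntDeriv_sub k hF.continuous]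
  have h1 := (hρ.hasFDerivAt_cutInt k (continuous_const (y := (1 : ℝ))) x).smul
    (hF x).hasFDerivAt
  have h2 := h1.sub (hρ.hasFDerivAt_cutInt k hF.continuous x)
  refine h2.congr_fderiv ?_
  abel

end CutIntegral

section ExpSlope

/-- The entire function `(exp a - 1) / a`. -/
def expSlope : ℝ → ℝ := dslope Real.exp 0

lemma mul_expSlope (a : ℝ) : a * expSlope a = Real.exp a - 1 := by
  simpa [expSlope] using sub_smul_dslope Real.exp 0 a

lemma contDiff_expSlope : ContDiff ℝ 1 expSlope := by
  rw [contDiff_iff_contDiffAt]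
  intro a
  rcases eq_or_ne a 0 with rfl | ha
  · obtain ⟨p, hp⟩ : AnalyticAt ℝ Real.exp 0 := by fun_prop
    have h : AnalyticAt ℝ expSlope 0 := hp.has_fpower_series_dslope_fslope.analyticAt
    exact h.contDiffAt
  · have h : expSlope =ᶠ[nhds a] fun a => (Real.exp a - 1) / a := by
      filter_upwards [isOpen_ne.mem_nhds ha] with b hb
      rw [eq_div_iff hb, mul_comm, mul_expSlope]
    exact ((Real.contDiff_exp.contDiffAt.sub contDiffAt_const).div contDiffAt_id ha).congr_of_eventuallyEq h

lemma exists_bound_expSlope : ∃ G : ℝ, 1 ≤ G ∧ ∀ a : ℝ, |a| ≤ 1 →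
    |expSlope a| ≤ G ∧ |deriv expSlope a| ≤ G := by
  obtain ⟨G₁, h₁⟩ := (isCompact_Icc (a := (-1 : ℝ)) (b := 1)).exists_bound_of_continuousOn
    contDiff_expSlope.continuous.continuousOn
  obtain ⟨G₂, h₂⟩ := (isCompact_Icc (a := (-1 : ℝ)) (b := 1)).exists_bound_of_continuousOn
    (contDiff_expSlope.continuous_deriv le_rfl).continuousOn
  refine ⟨max 1 (max G₁ G₂), le_max_left _ _, fun a ha => ?_⟩
  rw [abs_le] at ha
  exact ⟨(h₁ a ha).trans ((le_max_left _ _).trans (le_max_right _ _)),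
    (h₂ a ha).trans ((le_max_right _ _).trans (le_max_right _ _))⟩

end ExpSlope

section Step

variable {E : Type*} [NormedAddCommGroup E] [InnerProductSpace ℝ E] [FiniteDimensional ℝ E]
  [MeasurableSpace E] [BorelSpace E] {μ : Measure E} {ρ : E → ℝ}

/-- The mass of `ρ` near `x` at scale `k`. -/
def scaleMass (μ : Measure E) (ρ : E → ℝ) (k : ℕ) (x : E) : ℝ :=
  cutInt μ ρ k (fun _ => (1 : ℝ)) x

/-- The refinement of the map `F` at scale `k`. -/
def refineMap (μ : Measure E) (ρ : E → ℝ) (k : ℕ) (F : E → E) (x : E) : E :=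
  F x + expSlope (scaleMass μ ρ k x) • cutInt μ ρ k (fun y => F x - F y) x

/-- If the derivative of `F` is controlled by `exp U` and `U` is slowly varying at scale `k`,
then `F` is Lipschitz at scale `k`, with constant comparable to `exp U`. -/
lemma norm_sub_le_of_slowlyVarying {U : E → ℝ} {F : E → E} {B C : ℝ} {k : ℕ} (hC : 0 ≤ C)
    (hU : Differentiable ℝ U) (hU' : ∀ x, ‖x‖ * ‖fderiv ℝ U x‖ ≤ C * 2 ^ (k + 1))
    (hF : Differentiable ℝ F) (hF' : ∀ x, ‖fderiv ℝ F x‖ ≤ B * Real.exp (U x)) (hB : 0 ≤ B)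
    {x y : E} (hy : y ≠ 0) (hxy : relDist k x y < 1) :
    ‖F x - F y‖ ≤ B * Real.exp (2 * C) * Real.exp (U x) * ‖x - y‖ := by
  have hy' : 0 < ‖y‖ := norm_pos_iff.2 hy
  have h2 := two_mul_norm_sub_le_of_relDist hy hxy
  have hseg : ∀ z ∈ segment ℝ x y, ‖y‖ ≤ 2 * ‖z‖ ∧ ‖z - x‖ ≤ ‖x - y‖ := by
    rintro z ⟨s, t, hs, ht, hst, rfl⟩
    have e1 : s • x + t • y - y = s • (x - y) := by
      rw [eq_sub_of_add_eq' hst]; module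
    have e2 : s • x + t • y - x = t • (y - x) := by
      rw [eq_sub_of_add_eq hst]; module
    have n1 : ‖s • x + t • y - y‖ ≤ ‖x - y‖ := by
      rw [e1, norm_smul, Real.norm_eq_abs, abs_of_nonneg hs]
      exact mul_le_of_le_one_left (norm_nonneg _) (by linarith)
    have n2 : ‖s • x + t • y - x‖ ≤ ‖x - y‖ := by
      rw [e2, norm_smul, Real.norm_eq_abs, abs_of_nonneg ht, norm_sub_rev x y]
      exact mul_le_of_le_one_left (norm_nonneg _) (by linarith)
    refine ⟨?_, n2⟩
    have : ‖y‖ ≤ ‖s • x + t • y‖ + ‖s • x + t • y - y‖ := norm_le_insert _ _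
    linarith
  have hDU : ∀ z ∈ segment ℝ x y, ‖fderiv ℝ U z‖ ≤ C * 2 ^ (k + 1) * 2 / ‖y‖ := by
    intro z hz
    have h1 := (hseg z hz).1
    rw [le_div_iff₀ hy']
    have := hU' z
    nlinarith [norm_nonneg (fderiv ℝ U z)]
  have hUz : ∀ z ∈ segment ℝ x y, U z ≤ U x + 2 * C := by
    intro z hz
    have h1 := (convex_segment x y).norm_image_sub_le_of_norm_fderiv_le (𝕜 := ℝ)
      (fun w _ => hU w) hDU (left_mem_segment ℝ x y) hz
    have h3 : C * 2 ^ (k + 1) * 2 / ‖y‖ * ‖z - x‖ ≤ 2 * C := by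
      calc C * 2 ^ (k + 1) * 2 / ‖y‖ * ‖z - x‖ ≤ C * 2 ^ (k + 1) * 2 / ‖y‖ * ‖x - y‖ := by
            gcongr; exact (hseg z hz).2
        _ = 2 * C * relDist k x y := by rw [relDist]; ring
        _ ≤ 2 * C := mul_le_of_le_one_right (by positivity) hxy.le
    have := (le_abs_self _).trans (h1.trans h3)
    linarith
  have h1 := (convex_segment x y).norm_image_sub_le_of_norm_fderiv_le (𝕜 := ℝ)
    (C := B * Real.exp (2 * C) * Real.exp (U x))
    (fun w _ => hF w) (fun z hz => (hF' z).trans ?_) (right_mem_segment ℝ x y)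
    (left_mem_segment ℝ x y)
  · exact h1
  · rw [mul_assoc, ← Real.exp_add]
    gcongr
    linarith [hUz z hz]

/-- The derivative of the refined map, up to a controlled error. -/
lemma IsTailDensity.exists_hasFDerivAt_refineMap (hρ : IsTailDensity μ ρ) (k : ℕ) {F : E → E}
    (hF : Differentiable ℝ F) {x : E} {L G : ℝ} (hL : 0 ≤ L)
    (hFL : ∀ y, y ≠ 0 → relDist k x y < 1 → ‖F x - F y‖ ≤ L * ‖x - y‖)
    (hG : ∀ a : ℝ, |a| ≤ 1 → |expSlope a| ≤ G ∧ |deriv expSlope a| ≤ G)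
    (hsmall : ∫ y, |ρ y| ∂μ ≤ 1) :
    ∃ R : E →L[ℝ] E, HasFDerivAt (refineMap μ ρ k F)
      (Real.exp (scaleMass μ ρ k x) • fderiv ℝ F x + R) x ∧
      ‖R‖ ≤ 16 * G * L * truncMass μ ρ k x := by
  set a := scaleMass μ ρ k x with ha
  set m := truncMass μ ρ k x with hm
  set b := cutInt μ ρ k (fun y => F x - F y) x with hb
  set Da := cutIntDeriv μ ρ k (fun _ => (1 : ℝ)) x with hDa
  set Db := cutIntDeriv μ ρ k (fun y => F x - F y) x with hDb
  have ha1 : |a| ≤ 1 := (hρ.abs_cutInt_one_le k x).trans hsmall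
  have hm0 : 0 ≤ m := truncMass_nonneg k x
  have hm1 : m ≤ 1 := (hρ.truncMass_le k x).trans hsmall
  obtain ⟨hG1, hG2⟩ := hG a ha1
  have hG0 : 0 ≤ G := (abs_nonneg _).trans hG1
  have hD1 : HasFDerivAt (scaleMass μ ρ k) Da x := hρ.hasFDerivAt_cutInt k continuous_const x
  have hD2 : HasFDerivAt (fun x => expSlope (scaleMass μ ρ k x)) (deriv expSlope a • Da) x :=
    ((contDiff_expSlope.differentiable one_ne_zero) a).hasDerivAt.comp_hasFDerivAt x hD1
  have hD3 := (hF x).hasFDerivAt.add (hD2.smul (hρ.hasFDerivAt_cutInt_sub k hF x))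
  refine ⟨expSlope a • Db + (deriv expSlope a • Da).smulRight b, hD3.congr_fderiv ?_, ?_⟩
  · have : Real.exp a = 1 + a * expSlope a := by rw [mul_expSlope]; ring
    rw [this]
    change fderiv ℝ F x + (expSlope a • (a • fderiv ℝ F x + Db) +
      (deriv expSlope a • Da).smulRight b) = _
    module
  · have n1 : ‖b‖ ≤ 2 * L * ‖x‖ / 2 ^ (k + 1) * m := hρ.norm_cutInt_sub_le k hF.continuous hL hFL
    have n2 : ‖Db‖ ≤ 4 * L * m := hρ.norm_cutIntDeriv_sub_le k hF.continuous hL hFL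
    have n3 : ‖x‖ * ‖Da‖ ≤ 6 * 2 ^ (k + 1) * m := hρ.norm_mul_norm_cutIntDeriv_one_le k x
    have n4 : ‖Da‖ * ‖b‖ ≤ 12 * L * m := by
      calc ‖Da‖ * ‖b‖ ≤ ‖Da‖ * (2 * L * ‖x‖ / 2 ^ (k + 1) * m) := by gcongr
        _ = 2 * L / 2 ^ (k + 1) * m * (‖x‖ * ‖Da‖) := by ring
        _ ≤ 2 * L / 2 ^ (k + 1) * m * (6 * 2 ^ (k + 1) * m) := by gcongr
        _ = 12 * L * m * m := by field_simp; ring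
        _ ≤ 12 * L * m := mul_le_of_le_one_right (by positivity) hm1
    calc _ ≤ ‖expSlope a • Db‖ + ‖(deriv expSlope a • Da).smulRight b‖ := norm_add_le _ _
      _ = |expSlope a| * ‖Db‖ + |deriv expSlope a| * (‖Da‖ * ‖b‖) := by
        rw [ContinuousLinearMap.norm_smulRight_apply, norm_smul, norm_smul, Real.norm_eq_abs,
          Real.norm_eq_abs, mul_assoc]
      _ ≤ G * (4 * L * m) + G * (12 * L * m) := by gcongr
      _ = 16 * G * L * m := by ring

lemma IsTailDensity.norm_refineMap_sub_le (hρ : IsTailDensity μ ρ) (k : ℕ) {F : E → E}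
    (hF : Continuous F) {x : E} {L G : ℝ} (hL : 0 ≤ L)
    (hFL : ∀ y, y ≠ 0 → relDist k x y < 1 → ‖F x - F y‖ ≤ L * ‖x - y‖)
    (hG : ∀ a : ℝ, |a| ≤ 1 → |expSlope a| ≤ G ∧ |deriv expSlope a| ≤ G)
    (hsmall : ∫ y, |ρ y| ∂μ ≤ 1) :
    ‖refineMap μ ρ k F x - F x‖ ≤ G * (2 * L * ‖x‖ / 2 ^ (k + 1) * ∫ y, |ρ y| ∂μ) := by
  have hG1 := (hG _ ((hρ.abs_cutInt_one_le k x).trans hsmall)).1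
  rw [refineMap, add_sub_cancel_left, norm_smul, Real.norm_eq_abs]
  have hG0 : 0 ≤ G := (abs_nonneg _).trans hG1
  have h1 := hρ.norm_cutInt_sub_le k hF hL hFL
  have h2 := hρ.truncMass_le k x
  refine mul_le_mul hG1 (h1.trans ?_) (norm_nonneg _) hG0
  gcongr

end Step

section Flow

variable {E : Type*} [NormedAddCommGroup E] [InnerProductSpace ℝ E] [FiniteDimensional ℝ E]
  [MeasurableSpace E] [BorelSpace E] {μ : Measure E} {ρ : E → ℝ}

/-- The map obtained from `F₀` by refining at the scales `0, …, k - 1`. -/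
def flowMap (μ : Measure E) (ρ : E → ℝ) (F₀ : E → E) : ℕ → E → E
  | 0 => F₀
  | k + 1 => refineMap μ ρ k (flowMap μ ρ F₀ k)

/-- The logarithm of the conformal factor of `flowMap`. -/
def flowPot (μ : Measure E) (ρ : E → ℝ) (U₀ : E → ℝ) (k : ℕ) (x : E) : ℝ :=
  U₀ x + ∑ j ∈ Finset.range k, scaleMass μ ρ j x

/-- A map `F₀` whose derivative is controlled by a slowly varying factor `exp U₀`. -/
structure IsFlowStart (U₀ : E → ℝ) (F₀ : E → E) (C A : ℝ) : Prop where
  differentiable_pot : Differentiable ℝ U₀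
  differentiable_map : Differentiable ℝ F₀
  norm_fderiv_pot : ∀ x, ‖x‖ * ‖fderiv ℝ U₀ x‖ ≤ C
  norm_fderiv_map : ∀ x, ‖Real.exp (-U₀ x) • fderiv ℝ F₀ x‖ ≤ A
  norm_map : ∀ x, ‖F₀ x‖ = Real.exp (U₀ x) * ‖x‖

/-- The Lipschitz constant of the refined maps, in units of the conformal factor. -/
def flowLip (C A : ℝ) : ℝ := (A + 1) * Real.exp (2 * (C + 6))

/-- The density is small compared with the constants attached to the initial map. -/
structure IsFlowData (μ : Measure E) (ρ : E → ℝ) (U₀ : E → ℝ) (F₀ : E → E) (C A G : ℝ) :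
    Prop where
  start : IsFlowStart U₀ F₀ C A
  tail : IsTailDensity μ ρ
  one_le : 1 ≤ G
  slope : ∀ a : ℝ, |a| ≤ 1 → |expSlope a| ≤ G ∧ |deriv expSlope a| ≤ G
  small : ∫ y, |ρ y| ∂μ ≤ 1 / 4
  small' : 64 * (G * flowLip C A) * ∫ y, |ρ y| ∂μ ≤ 1

variable {U₀ : E → ℝ} {F₀ : E → E} {C A G : ℝ}

lemma IsFlowStart.nonneg (h : IsFlowStart U₀ F₀ C A) : 0 ≤ C ∧ 0 ≤ A :=
  ⟨le_trans (by positivity) (h.norm_fderiv_pot 0), le_trans (norm_nonneg _) (h.norm_fderiv_map 0)⟩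

lemma IsFlowData.abs_scaleMass_le (h : IsFlowData μ ρ U₀ F₀ C A G) (k : ℕ) (x : E) :
    |scaleMass μ ρ k x| ≤ 1 / 4 :=
  (h.tail.abs_cutInt_one_le k x).trans h.small

lemma exp_quarter_le : Real.exp (1 / 4) ≤ 4 / 3 := by
  have := Real.exp_bound_div_one_sub_of_interval (x := 1 / 4) (by norm_num) (by norm_num)
  norm_num at this ⊢
  exact this

lemma IsFlowData.exp_flowPot_le (h : IsFlowData μ ρ U₀ F₀ C A G) (k : ℕ) (x : E) :
    Real.exp (flowPot μ ρ U₀ k x) ≤ Real.exp (U₀ x) * (4 / 3) ^ k := by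
  rw [flowPot, Real.exp_add, Real.exp_sum]
  gcongr
  calc ∏ j ∈ Finset.range k, Real.exp (scaleMass μ ρ j x)
      ≤ ∏ j ∈ Finset.range k, (4 / 3 : ℝ) :=
        Finset.prod_le_prod (fun j _ => (Real.exp_pos _).le) fun j _ =>
          (Real.exp_le_exp.2 ((le_abs_self _).trans (h.abs_scaleMass_le j x))).trans exp_quarter_le
    _ = (4 / 3) ^ k := by rw [Finset.prod_const, Finset.card_range]

lemma IsFlowData.differentiable_flowPot (h : IsFlowData μ ρ U₀ F₀ C A G) (k : ℕ) :
    Differentiable ℝ (flowPot μ ρ U₀ k) ∧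
      ∀ x, ‖x‖ * ‖fderiv ℝ (flowPot μ ρ U₀ k) x‖ ≤ (C + 6) * 2 ^ (k + 1) := by
  have hC := h.start.nonneg.1
  have key : ∀ x, HasFDerivAt (flowPot μ ρ U₀ k) (fderiv ℝ U₀ x +
      ∑ j ∈ Finset.range k, cutIntDeriv μ ρ j (fun _ => (1 : ℝ)) x) x := fun x =>
    (h.start.differentiable_pot x).hasFDerivAt.add
      (HasFDerivAt.fun_sum fun j _ => h.tail.hasFDerivAt_cutInt j continuous_const x)
  refine ⟨fun x => (key x).differentiableAt, fun x => ?_⟩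
  rw [(key x).fderiv]
  have h1 : ∀ j, ‖x‖ * ‖cutIntDeriv μ ρ j (fun _ => (1 : ℝ)) x‖ ≤ 6 * 2 ^ (j + 1) := fun j => by
    refine (h.tail.norm_mul_norm_cutIntDeriv_one_le j x).trans (mul_le_of_le_one_right
      (by positivity) ((h.tail.truncMass_le j x).trans (h.small.trans (by norm_num))))
  have hgeo : ∀ k : ℕ, ∑ j ∈ Finset.range k, 6 * (2 : ℝ) ^ (j + 1) ≤ 6 * 2 ^ (k + 1) := by
    intro k
    induction k with
    | zero => simp
    | succ k ih =>
      rw [Finset.sum_range_succ, pow_succ 2 (k + 1)]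
      linarith
  have h2 : (1 : ℝ) ≤ 2 ^ (k + 1) := one_le_pow₀ one_le_two
  calc _ ≤ ‖x‖ * (‖fderiv ℝ U₀ x‖ +
        ∑ j ∈ Finset.range k, ‖cutIntDeriv μ ρ j (fun _ => (1 : ℝ)) x‖) := by
        gcongr
        exact (norm_add_le _ _).trans (by gcongr; exact norm_sum_le _ _)
    _ = ‖x‖ * ‖fderiv ℝ U₀ x‖ +
        ∑ j ∈ Finset.range k, ‖x‖ * ‖cutIntDeriv μ ρ j (fun _ => (1 : ℝ)) x‖ := by
        rw [mul_add, Finset.mul_sum]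
    _ ≤ C + ∑ j ∈ Finset.range k, 6 * 2 ^ (j + 1) :=
        add_le_add (h.start.norm_fderiv_pot x) (Finset.sum_le_sum fun j _ => h1 j)
    _ ≤ C + 6 * 2 ^ (k + 1) := by gcongr; exact hgeo k
    _ ≤ (C + 6) * 2 ^ (k + 1) := by nlinarith

lemma flowPot_succ (k : ℕ) (x : E) :
    flowPot μ ρ U₀ (k + 1) x = flowPot μ ρ U₀ k x + scaleMass μ ρ k x := by
  rw [flowPot, flowPot, Finset.sum_range_succ, add_assoc]

lemma IsFlowData.flowLip_pos (h : IsFlowData μ ρ U₀ F₀ C A G) : 1 ≤ flowLip C A := by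
  have h1 := h.start.nonneg
  have : 1 ≤ Real.exp (2 * (C + 6)) := Real.one_le_exp (by linarith)
  unfold flowLip
  nlinarith

lemma IsFlowData.normalized_bound (h : IsFlowData μ ρ U₀ F₀ C A G) (x : E) (k : ℕ) :
    32 * (G * flowLip C A) * ∑ j ∈ Finset.range k, truncMass μ ρ j x ≤
      64 * (G * flowLip C A) * ∫ y, |ρ y| ∂μ := by
  have h1 := h.tail.sum_truncMass_le x k
  have h2 := h.flowLip_pos
  have h3 := h.one_le
  calc _ ≤ 32 * (G * flowLip C A) * (2 * ∫ y, |ρ y| ∂μ) := by gcongr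
    _ = _ := by ring

lemma IsFlowData.norm_fderiv_le (h : IsFlowData μ ρ U₀ F₀ C A G) {k : ℕ} {x : E}
    {D : E →L[ℝ] E} (hD : ‖Real.exp (-flowPot μ ρ U₀ k x) • D -
      Real.exp (-U₀ x) • fderiv ℝ F₀ x‖ ≤
        32 * (G * flowLip C A) * ∑ j ∈ Finset.range k, truncMass μ ρ j x) :
    ‖D‖ ≤ (A + 1) * Real.exp (flowPot μ ρ U₀ k x) := by
  have h1 := hD.trans ((h.normalized_bound x k).trans h.small')
  have h2 := h.start.norm_fderiv_map x
  have h3 : ‖Real.exp (-flowPot μ ρ U₀ k x) • D‖ ≤ A + 1 := by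
    have := norm_le_norm_add_norm_sub' (Real.exp (-flowPot μ ρ U₀ k x) • D)
      (Real.exp (-U₀ x) • fderiv ℝ F₀ x)
    linarith
  rw [norm_smul, Real.norm_eq_abs, abs_of_pos (Real.exp_pos _), Real.exp_neg,
    inv_mul_le_iff₀ (Real.exp_pos _)] at h3
  linarith

lemma IsFlowData.flowMap_bound (h : IsFlowData μ ρ U₀ F₀ C A G) (k : ℕ) :
    Differentiable ℝ (flowMap μ ρ F₀ k) ∧ ∀ x,
      ‖Real.exp (-flowPot μ ρ U₀ k x) • fderiv ℝ (flowMap μ ρ F₀ k) x -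
        Real.exp (-U₀ x) • fderiv ℝ F₀ x‖ ≤
        32 * (G * flowLip C A) * ∑ j ∈ Finset.range k, truncMass μ ρ j x := by
  induction k with
  | zero => exact ⟨h.start.differentiable_map, fun x => by simp [flowPot, flowMap]⟩
  | succ k ih =>
    obtain ⟨hd, hb⟩ := ih
    have hnn := h.start.nonneg
    have hU := h.differentiable_flowPot k
    have hL := h.flowLip_pos
    have hG := h.one_le
    have key := fun x => h.tail.exists_hasFDerivAt_refineMap k hd (x := x)
      (L := flowLip C A * Real.exp (flowPot μ ρ U₀ k x)) (by positivity)
      (fun y hy hxy => norm_sub_le_of_slowlyVarying (by linarith) hU.1 hU.2 hd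
        (fun z => h.norm_fderiv_le (hb z)) (by linarith) hy hxy) h.slope
      (h.small.trans (by norm_num))
    refine ⟨fun x => (key x).choose_spec.1.differentiableAt, fun x => ?_⟩
    obtain ⟨R, hR, hRn⟩ := key x
    set a := scaleMass μ ρ k x with ha
    have hm := truncMass_nonneg (μ := μ) (ρ := ρ) k x
    have hR' : fderiv ℝ (flowMap μ ρ F₀ (k + 1)) x =
        Real.exp a • fderiv ℝ (flowMap μ ρ F₀ k) x + R := hR.fderiv
    have e1 : Real.exp (-flowPot μ ρ U₀ (k + 1) x) * Real.exp a =
        Real.exp (-flowPot μ ρ U₀ k x) := by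
      rw [← Real.exp_add, flowPot_succ, ← ha]; congr 1; ring
    have e2 : Real.exp (-flowPot μ ρ U₀ (k + 1) x) * Real.exp (flowPot μ ρ U₀ k x) ≤ 2 := by
      rw [← Real.exp_add, flowPot_succ, ← ha]
      have : -(flowPot μ ρ U₀ k x + a) + flowPot μ ρ U₀ k x ≤ 1 / 4 := by
        have := (neg_le_abs a).trans (h.abs_scaleMass_le k x)
        linarith
      exact (Real.exp_le_exp.2 this).trans (exp_quarter_le.trans (by norm_num))
    rw [hR', smul_add, smul_smul, e1, add_sub_right_comm, Finset.sum_range_succ, mul_add]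
    refine (norm_add_le _ _).trans (add_le_add (hb x) ?_)
    rw [norm_smul, Real.norm_eq_abs, abs_of_pos (Real.exp_pos _)]
    calc _ ≤ Real.exp (-flowPot μ ρ U₀ (k + 1) x) *
          (16 * G * (flowLip C A * Real.exp (flowPot μ ρ U₀ k x)) * truncMass μ ρ k x) := by gcongr
      _ = (Real.exp (-flowPot μ ρ U₀ (k + 1) x) * Real.exp (flowPot μ ρ U₀ k x)) *
          (16 * (G * flowLip C A) * truncMass μ ρ k x) := by ring
      _ ≤ 2 * (16 * (G * flowLip C A) * truncMass μ ρ k x) := by gcongr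
      _ = _ := by ring

lemma IsFlowData.norm_flowMap_sub_le (h : IsFlowData μ ρ U₀ F₀ C A G) (k : ℕ) (x : E) {y : E}
    (hy : y ≠ 0) (hxy : relDist k x y < 1) :
    ‖flowMap μ ρ F₀ k x - flowMap μ ρ F₀ k y‖ ≤
      flowLip C A * Real.exp (flowPot μ ρ U₀ k x) * ‖x - y‖ := by
  have hnn := h.start.nonneg
  have hU := h.differentiable_flowPot k
  exact norm_sub_le_of_slowlyVarying (by linarith) hU.1 hU.2 (h.flowMap_bound k).1
    (fun z => h.norm_fderiv_le ((h.flowMap_bound k).2 z)) (by linarith) hy hxy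

lemma IsFlowData.norm_fderiv_flowMap_succ_sub_le (h : IsFlowData μ ρ U₀ F₀ C A G) (k : ℕ)
    (x : E) : ‖fderiv ℝ (flowMap μ ρ F₀ (k + 1)) x - fderiv ℝ (flowMap μ ρ F₀ k) x‖ ≤
      16 * (G * flowLip C A) * (Real.exp (U₀ x) * (4 / 3) ^ k) *
        (|scaleMass μ ρ k x| + truncMass μ ρ k x) := by
  have hL := h.flowLip_pos
  have hG := h.one_le
  have hnn := h.start.nonneg
  obtain ⟨R, hR, hRn⟩ := h.tail.exists_hasFDerivAt_refineMap k (h.flowMap_bound k).1 (x := x)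
    (L := flowLip C A * Real.exp (flowPot μ ρ U₀ k x)) (by positivity)
    (fun y hy hxy => h.norm_flowMap_sub_le k x hy hxy) h.slope (h.small.trans (by norm_num))
  set a := scaleMass μ ρ k x with ha
  have ha1 : |a| ≤ 1 := (h.abs_scaleMass_le k x).trans (by norm_num)
  have hm := truncMass_nonneg (μ := μ) (ρ := ρ) k x
  have hR' : fderiv ℝ (flowMap μ ρ F₀ (k + 1)) x =
      Real.exp a • fderiv ℝ (flowMap μ ρ F₀ k) x + R := hR.fderiv
  have hD := h.norm_fderiv_le ((h.flowMap_bound k).2 x)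
  have hAL : A + 1 ≤ flowLip C A := by
    have : 1 ≤ Real.exp (2 * (C + 6)) := Real.one_le_exp (by linarith)
    unfold flowLip
    nlinarith
  have hE := h.exp_flowPot_le k x
  have e1 : Real.exp a • fderiv ℝ (flowMap μ ρ F₀ k) x + R - fderiv ℝ (flowMap μ ρ F₀ k) x =
      (a * expSlope a) • fderiv ℝ (flowMap μ ρ F₀ k) x + R := by
    rw [mul_expSlope]; module
  rw [hR', e1]
  calc _ ≤ |a| * |expSlope a| * ‖fderiv ℝ (flowMap μ ρ F₀ k) x‖ + ‖R‖ := by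
        refine (norm_add_le _ _).trans ?_
        rw [norm_smul, norm_mul, Real.norm_eq_abs, Real.norm_eq_abs]
    _ ≤ |a| * G * (flowLip C A * (Real.exp (U₀ x) * (4 / 3) ^ k)) +
        16 * G * (flowLip C A * (Real.exp (U₀ x) * (4 / 3) ^ k)) * truncMass μ ρ k x := by
        gcongr
        · exact (h.slope a ha1).1
        · exact hD.trans (by gcongr)
        · exact hRn.trans (by gcongr)
    _ ≤ 16 * (|a| * G * (flowLip C A * (Real.exp (U₀ x) * (4 / 3) ^ k))) +
        16 * G * (flowLip C A * (Real.exp (U₀ x) * (4 / 3) ^ k)) * truncMass μ ρ k x := by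
        have hp : 0 ≤ |a| * G * (flowLip C A * (Real.exp (U₀ x) * (4 / 3) ^ k)) := by positivity
        linarith
    _ = _ := by ring

lemma IsFlowData.norm_flowMap_succ_sub_le (h : IsFlowData μ ρ U₀ F₀ C A G) (k : ℕ)
    (x : E) : ‖flowMap μ ρ F₀ (k + 1) x - flowMap μ ρ F₀ k x‖ ≤
      1 / 6 * ‖F₀ x‖ * (2 / 3) ^ k := by
  have hL := h.flowLip_pos
  have hG := h.one_le
  have hI : 0 ≤ ∫ y, |ρ y| ∂μ := integral_nonneg fun _ => abs_nonneg _
  have h1 := h.tail.norm_refineMap_sub_le k (h.flowMap_bound k).1.continuous (x := x)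
    (L := flowLip C A * Real.exp (flowPot μ ρ U₀ k x)) (by positivity)
    (fun y hy hxy => h.norm_flowMap_sub_le k x hy hxy) h.slope (h.small.trans (by norm_num))
  have hE := h.exp_flowPot_le k x
  have hs : G * flowLip C A * ∫ y, |ρ y| ∂μ ≤ 1 / 6 := by
    have := h.small'
    nlinarith
  refine h1.trans ?_
  calc _ ≤ G * (2 * (flowLip C A * (Real.exp (U₀ x) * (4 / 3) ^ k)) * ‖x‖ / 2 ^ (k + 1) *
        ∫ y, |ρ y| ∂μ) := by gcongr
    _ = (G * flowLip C A * ∫ y, |ρ y| ∂μ) * (Real.exp (U₀ x) * ‖x‖) * ((4 / 3) ^ k / 2 ^ k) := by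
        rw [pow_succ]; field_simp
    _ ≤ 1 / 6 * ‖F₀ x‖ * (2 / 3) ^ k := by
        rw [h.start.norm_map, ← div_pow]
        norm_num
        gcongr

end Flow

section Limit

variable {E : Type*} [NormedAddCommGroup E] [InnerProductSpace ℝ E] [FiniteDimensional ℝ E]
  [MeasurableSpace E] [BorelSpace E] {μ : Measure E} {ρ : E → ℝ}

lemma IsTailDensity.exists_decay [Nontrivial E] [μ.IsAddHaarMeasure] (hρ : IsTailDensity μ ρ)
    (r : ℝ) : ∃ D : ℝ, 0 ≤ D ∧ ∀ (k : ℕ) (x : E), ‖x‖ ≤ r → ∀ w : E → ℝ,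
      (∀ y, 0 ≤ w y) → (∀ y, w y ≤ 1) → (∀ y, 1 ≤ relDist k x y → w y = 0) →
      ∫ y, w y * |ρ y| ∂μ ≤ D / 2 ^ k := by
  obtain ⟨M, hM⟩ := hρ.locallyBounded (2 * max r 0)
  have hM0 : 0 ≤ M := (abs_nonneg _).trans (hM 0 (by simp))
  set s := max r 0 with hs
  have hs0 : 0 ≤ s := le_max_right _ _
  refine ⟨M * (s ^ Module.finrank ℝ E * μ.real (ball 0 1)), by positivity,
    fun k x hx w hw0 hw1 hw => ?_⟩
  have hd : 1 ≤ Module.finrank ℝ E := Module.finrank_pos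
  have hball : μ.real (closedBall x (s / 2 ^ k)) ≤
      s ^ Module.finrank ℝ E * μ.real (ball 0 1) / 2 ^ k := by
    rw [Measure.addHaar_real_closedBall μ x (by positivity), div_pow, div_mul_eq_mul_div]
    gcongr
    exact le_self_pow₀ (one_le_pow₀ one_le_two) (by omega)
  have hint : Integrable ((closedBall x (s / 2 ^ k)).indicator fun _ => M) μ :=
    (integrable_indicator_iff measurableSet_closedBall).2
      (integrableOn_const (isCompact_closedBall _ _).measure_lt_top.ne)
  calc ∫ y, w y * |ρ y| ∂μ ≤ ∫ y, (closedBall x (s / 2 ^ k)).indicator (fun _ => M) y ∂μ := by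
        refine integral_mono_of_nonneg
          (Eventually.of_forall fun y => mul_nonneg (hw0 y) (abs_nonneg _)) hint
          (Eventually.of_forall fun y => ?_)
        have hnn : 0 ≤ (closedBall x (s / 2 ^ k)).indicator (fun _ => M) y :=
          indicator_nonneg (fun _ _ => hM0) y
        by_cases h0 : ρ y = 0
        · simpa [h0] using hnn
        rcases le_or_gt 1 (relDist k x y) with h | h
        · simpa [hw y h] using hnn
        have h1 := norm_le_two_mul_of_relDist (hρ.ne_zero' h0) h
        have h2 := norm_sub_le_of_relDist (hρ.ne_zero' h0) h
        have h3 : ‖x‖ ≤ s := hx.trans (le_max_left _ _)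
        have hmem : y ∈ closedBall x (s / 2 ^ k) := by
          rw [mem_closedBall, dist_eq_norm, norm_sub_rev, le_div_iff₀ (by positivity)]
          rw [pow_succ] at h2
          linarith
        rw [indicator_of_mem hmem]
        calc w y * |ρ y| ≤ 1 * M := by
              gcongr
              · exact hw1 y
              · exact hM y (by linarith)
          _ = M := one_mul _
    _ = M * μ.real (closedBall x (s / 2 ^ k)) := by
        rw [integral_indicator measurableSet_closedBall, setIntegral_const, smul_eq_mul, mul_comm]
    _ ≤ M * (s ^ Module.finrank ℝ E * μ.real (ball 0 1) / 2 ^ k) := by gcongr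
    _ = _ := by ring

lemma truncDist_eq_zero {k : ℕ} {x y : E} (h : 1 ≤ relDist k x y) : truncDist k x y = 0 :=
  if_neg h.not_gt

lemma abs_scaleMass_le_integral (k : ℕ) (x : E) :
    |scaleMass μ ρ k x| ≤ ∫ y, bump k x y * |ρ y| ∂μ := by
  unfold scaleMass cutInt
  rw [← Real.norm_eq_abs]
  refine (norm_integral_le_integral_norm _).trans (le_of_eq (integral_congr_ae
    (Eventually.of_forall fun y => ?_)))
  simp [abs_of_nonneg (bump_nonneg k x y)]

variable {U₀ : E → ℝ} {F₀ : E → E} {C A G : ℝ}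

/-- The limit of the refined maps `flowMap`. -/
def limitMap (μ : Measure E) (ρ : E → ℝ) (F₀ : E → E) (x : E) : E :=
  F₀ x + ∑' k, (flowMap μ ρ F₀ (k + 1) x - flowMap μ ρ F₀ k x)

/-- The logarithm of the conformal factor of `limitMap`. -/
def limitPot (μ : Measure E) (ρ : E → ℝ) (U₀ : E → ℝ) (x : E) : ℝ :=
  U₀ x + ∑' k, scaleMass μ ρ k x

lemma summable_two_thirds (c : ℝ) : Summable fun k : ℕ => c * (2 / 3 : ℝ) ^ k :=
  (summable_geometric_of_lt_one (by norm_num) (by norm_num)).mul_left c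

lemma IsTailDensity.exists_scaleMass_decay [Nontrivial E] [μ.IsAddHaarMeasure]
    (hρ : IsTailDensity μ ρ) (r : ℝ) : ∃ D : ℝ, 0 ≤ D ∧ ∀ (k : ℕ) (x : E), ‖x‖ ≤ r →
      (∫ y, bump k x y * |ρ y| ∂μ) ≤ D / 2 ^ k ∧ truncMass μ ρ k x ≤ D / 2 ^ k := by
  obtain ⟨D, hD0, hD⟩ := hρ.exists_decay r
  exact ⟨D, hD0, fun k x hx => ⟨hD k x hx _ (bump_nonneg k x) (bump_le_one k x)
    fun y hy => bump_eq_zero hy, hD k x hx _ (truncDist_nonneg k x) (truncDist_le_one k x)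
    fun y hy => truncDist_eq_zero hy⟩⟩

lemma IsTailDensity.summable_scaleMass [Nontrivial E] [μ.IsAddHaarMeasure]
    (hρ : IsTailDensity μ ρ) (x : E) : Summable fun k => scaleMass μ ρ k x := by
  obtain ⟨D, hD0, hD⟩ := hρ.exists_scaleMass_decay ‖x‖
  refine Summable.of_norm_bounded (g := fun k => D * (1 / 2 : ℝ) ^ k)
    ((summable_geometric_of_lt_one (by norm_num) (by norm_num)).mul_left D) fun k => ?_
  rw [one_div_pow, mul_one_div]
  exact (abs_scaleMass_le_integral k x).trans (hD k x le_rfl).1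

lemma IsTailDensity.exists_tsum_scaleMass_le [Nontrivial E] [μ.IsAddHaarMeasure]
    (hρ : IsTailDensity μ ρ) (r : ℝ) :
    ∃ M : ℝ, ∀ x : E, ‖x‖ ≤ r → |∑' k, scaleMass μ ρ k x| ≤ M := by
  obtain ⟨D, hD0, hD⟩ := hρ.exists_scaleMass_decay r
  refine ⟨D * 2, fun x hx => ?_⟩
  rw [← Real.norm_eq_abs]
  refine tsum_of_norm_bounded (hasSum_geometric_two.mul_left D) fun k => ?_
  rw [one_div_pow, mul_one_div]
  exact (abs_scaleMass_le_integral k x).trans (hD k x hx).1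

lemma IsFlowData.norm_limitMap_sub_le (h : IsFlowData μ ρ U₀ F₀ C A G) (x : E) :
    ‖limitMap μ ρ F₀ x - F₀ x‖ ≤ 1 / 2 * ‖F₀ x‖ := by
  rw [limitMap, add_sub_cancel_left]
  have hg : HasSum (fun k : ℕ => 1 / 6 * ‖F₀ x‖ * (2 / 3 : ℝ) ^ k) (1 / 6 * ‖F₀ x‖ * 3) := by
    have := hasSum_geometric_of_lt_one (r := (2 / 3 : ℝ)) (by norm_num) (by norm_num)
    norm_num at this
    exact this.mul_left _
  refine (tsum_of_norm_bounded hg fun k => h.norm_flowMap_succ_sub_le k x).trans (le_of_eq ?_)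
  ring

lemma IsFlowData.exists_hasFDerivAt_limitMap [Nontrivial E] [μ.IsAddHaarMeasure]
    (h : IsFlowData μ ρ U₀ F₀ C A G) (x : E) :
    ∃ D : E →L[ℝ] E, HasFDerivAt (limitMap μ ρ F₀) D x ∧
      Tendsto (fun k => fderiv ℝ (flowMap μ ρ F₀ k) x) atTop (nhds D) := by
  set r := ‖x‖ + 1 with hr
  obtain ⟨D, hD0, hD⟩ := h.tail.exists_scaleMass_decay r
  obtain ⟨M, hM⟩ := (isCompact_closedBall (0 : E) r).exists_bound_of_continuousOn
    (h.start.differentiable_pot.continuous.rexp).continuousOn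
  have hL := h.flowLip_pos
  have hG := h.one_le
  have hdiff := fun k => (h.flowMap_bound k).1
  set g : ℕ → E → E := fun k z => flowMap μ ρ F₀ (k + 1) z - flowMap μ ρ F₀ k z with hg
  have hgd : ∀ k z, HasFDerivAt (g k)
      (fderiv ℝ (flowMap μ ρ F₀ (k + 1)) z - fderiv ℝ (flowMap μ ρ F₀ k) z) z := fun k z =>
    (hdiff (k + 1) z).hasFDerivAt.sub (hdiff k z).hasFDerivAt
  have hbound : ∀ k, ∀ z ∈ ball (0 : E) r,
      ‖fderiv ℝ (flowMap μ ρ F₀ (k + 1)) z - fderiv ℝ (flowMap μ ρ F₀ k) z‖ ≤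
        16 * (G * flowLip C A) * M * (2 * D) * (2 / 3 : ℝ) ^ k := by
    intro k z hz
    have hz' : ‖z‖ ≤ r := (mem_ball_zero_iff.1 hz).le
    have h1 := hD k z hz'
    have h2 := (le_abs_self _).trans (hM z (mem_closedBall_zero_iff.2 hz'))
    have h3 := truncMass_nonneg (μ := μ) (ρ := ρ) k z
    have hM0 : 0 ≤ M := (Real.exp_pos _).le.trans h2
    refine (h.norm_fderiv_flowMap_succ_sub_le k z).trans ?_
    calc _ ≤ 16 * (G * flowLip C A) * (M * (4 / 3) ^ k) * (D / 2 ^ k + D / 2 ^ k) := by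
          gcongr
          · exact (abs_scaleMass_le_integral k z).trans h1.1
          · exact h1.2
      _ = 16 * (G * flowLip C A) * M * (2 * D) * ((4 / 3) ^ k / 2 ^ k) := by ring
      _ = _ := by rw [← div_pow]; norm_num
  have hx : x ∈ ball (0 : E) r := by rw [mem_ball_zero_iff]; linarith
  have hsum0 : Summable fun k => g k x :=
    Summable.of_norm_bounded (summable_two_thirds _) fun k => h.norm_flowMap_succ_sub_le k x
  have hsum := hasFDerivAt_tsum_of_isPreconnected (summable_two_thirds _) isOpen_ball
    (convex_ball (0 : E) r).isPreconnected (fun k z _ => hgd k z) hbound hx hsum0 hx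
  refine ⟨_, (h.start.differentiable_map x).hasFDerivAt.add hsum, ?_⟩
  have hs : HasSum (fun k => fderiv ℝ (flowMap μ ρ F₀ (k + 1)) x - fderiv ℝ (flowMap μ ρ F₀ k) x)
      _ := (Summable.of_norm_bounded (summable_two_thirds _) fun k => hbound k x hx).hasSum
  have ht := hs.tendsto_sum_nat.const_add (fderiv ℝ F₀ x)
  refine ht.congr fun k => ?_
  rw [Finset.sum_range_sub (fun k => fderiv ℝ (flowMap μ ρ F₀ k) x) k]
  exact add_sub_cancel _ _

lemma IsFlowData.differentiable_limitMap [Nontrivial E] [μ.IsAddHaarMeasure]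
    (h : IsFlowData μ ρ U₀ F₀ C A G) : Differentiable ℝ (limitMap μ ρ F₀) := fun x =>
  (h.exists_hasFDerivAt_limitMap x).choose_spec.1.differentiableAt

lemma IsFlowData.norm_fderiv_limitMap_sub_le [Nontrivial E] [μ.IsAddHaarMeasure]
    (h : IsFlowData μ ρ U₀ F₀ C A G) (x : E) :
    ‖Real.exp (-limitPot μ ρ U₀ x) • fderiv ℝ (limitMap μ ρ F₀) x -
      Real.exp (-U₀ x) • fderiv ℝ F₀ x‖ ≤ 64 * (G * flowLip C A) * ∫ y, |ρ y| ∂μ := by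
  obtain ⟨D, hD, hlim⟩ := h.exists_hasFDerivAt_limitMap x
  rw [hD.fderiv]
  have hp : Tendsto (fun k => flowPot μ ρ U₀ k x) atTop (nhds (limitPot μ ρ U₀ x)) :=
    (h.tail.summable_scaleMass x).hasSum.tendsto_sum_nat.const_add (U₀ x)
  have ht := (((Real.continuous_exp.tendsto _).comp hp.neg).smul hlim).sub_const
    (Real.exp (-U₀ x) • fderiv ℝ F₀ x)
  exact le_of_tendsto ht.norm (Eventually.of_forall fun k =>
    ((h.flowMap_bound k).2 x).trans (h.normalized_bound x k))

end Limit

section InitialMap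

variable {E : Type*} [NormedAddCommGroup E] [InnerProductSpace ℝ E] [FiniteDimensional ℝ E]
  [MeasurableSpace E] [BorelSpace E] {μ : Measure E} {σ : E → ℝ}

/-- A regularization of the logarithmic potential of a mass `a` near the origin and of the
tail density `σ`. -/
def initPot (μ : Measure E) (σ : E → ℝ) (a : ℝ) (x : E) : ℝ :=
  -(a / 2) * Real.log (1 + ‖x‖ ^ 2) - 1 / 2 * ∫ y, Real.log (1 + ‖x‖ ^ 2 / ‖y‖ ^ 2) * σ y ∂μ

/-- The function `q` with `∇ (initPot) = -q x`. -/
def initSlope (μ : Measure E) (σ : E → ℝ) (a : ℝ) (x : E) : ℝ :=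
  a / (1 + ‖x‖ ^ 2) + ∫ y, σ y / (‖y‖ ^ 2 + ‖x‖ ^ 2) ∂μ

/-- The radial map with conformal factor `exp (initPot)`. -/
def initMap (μ : Measure E) (σ : E → ℝ) (a : ℝ) (x : E) : E := Real.exp (initPot μ σ a x) • x

lemma hasFDerivAt_log_one_add_norm_sq {s : ℝ} (hs : 0 < s) (x : E) :
    HasFDerivAt (fun x : E => Real.log (1 + ‖x‖ ^ 2 / s)) ((2 / (s + ‖x‖ ^ 2)) • innerSL ℝ x) x := by
  have h1 : HasFDerivAt (fun x : E => 1 + ‖x‖ ^ 2 / s) (s⁻¹ • (2 • innerSL ℝ x)) x := by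
    simp only [div_eq_inv_mul]
    exact ((hasStrictFDerivAt_norm_sq x).hasFDerivAt.const_mul s⁻¹).const_add 1
  have hpos : 0 < 1 + ‖x‖ ^ 2 / s := by positivity
  convert h1.log hpos.ne' using 1
  rw [← Nat.cast_smul_eq_nsmul ℝ, smul_smul, smul_smul]
  congr 1
  field_simp
  push_cast
  ring

lemma log_one_add_nonneg {s : ℝ} (hs : 0 ≤ s) (x : E) : 0 ≤ Real.log (1 + ‖x‖ ^ 2 / s) :=
  Real.log_nonneg (le_add_of_nonneg_right (by positivity))

lemma log_one_add_le {y : E} (hy : 1 ≤ ‖y‖) (x : E) :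
    Real.log (1 + ‖x‖ ^ 2 / ‖y‖ ^ 2) ≤ Real.log (1 + ‖x‖ ^ 2) := by
  gcongr
  exact div_le_self (by positivity) (one_le_pow₀ hy)

lemma IsTailDensity.norm_log_mul_le (hσ : IsTailDensity μ σ) (x y : E) :
    ‖Real.log (1 + ‖x‖ ^ 2 / ‖y‖ ^ 2) * σ y‖ ≤ Real.log (1 + ‖x‖ ^ 2) * |σ y| := by
  by_cases h0 : σ y = 0
  · simp [h0]
  rw [norm_mul, Real.norm_eq_abs, Real.norm_eq_abs,
    abs_of_nonneg (log_one_add_nonneg (by positivity) x)]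
  gcongr ?_ * _
  exact log_one_add_le (hσ.ne_zero h0) x

lemma IsTailDensity.integrable_log_mul (hσ : IsTailDensity μ σ) (x : E) :
    Integrable (fun y => Real.log (1 + ‖x‖ ^ 2 / ‖y‖ ^ 2) * σ y) μ := by
  refine (hσ.integrable.abs.const_mul (Real.log (1 + ‖x‖ ^ 2))).mono' ?_
    (Eventually.of_forall (hσ.norm_log_mul_le x))
  have : Measurable fun y : E => Real.log (1 + ‖x‖ ^ 2 / ‖y‖ ^ 2) := by fun_prop
  exact this.aestronglyMeasurable.mul hσ.integrable.1

lemma IsTailDensity.abs_div_le (hσ : IsTailDensity μ σ) (x y : E) :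
    |σ y / (‖y‖ ^ 2 + ‖x‖ ^ 2)| ≤ |σ y| ∧ |σ y / (‖y‖ ^ 2 + ‖x‖ ^ 2)| * ‖x‖ ^ 2 ≤ |σ y| := by
  by_cases h0 : σ y = 0
  · simp [h0]
  have hy := one_le_pow₀ (n := 2) (hσ.ne_zero h0)
  have hp : 0 < ‖y‖ ^ 2 + ‖x‖ ^ 2 := by positivity
  rw [abs_div, abs_of_pos hp]
  refine ⟨div_le_self (abs_nonneg _) (by nlinarith [sq_nonneg ‖x‖]), ?_⟩
  rw [div_mul_eq_mul_div, div_le_iff₀ hp]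
  gcongr
  linarith

lemma IsTailDensity.integrable_div (hσ : IsTailDensity μ σ) (x : E) :
    Integrable (fun y => σ y / (‖y‖ ^ 2 + ‖x‖ ^ 2)) μ := by
  refine hσ.integrable.abs.mono' ?_ (Eventually.of_forall fun y => (hσ.abs_div_le x y).1)
  have : Measurable fun y : E => (‖y‖ ^ 2 + ‖x‖ ^ 2)⁻¹ := by fun_prop
  exact hσ.integrable.1.mul this.aestronglyMeasurable

lemma IsTailDensity.hasFDerivAt_initPot (hσ : IsTailDensity μ σ) (a : ℝ) (x : E) :
    HasFDerivAt (initPot μ σ a) (-initSlope μ σ a x • innerSL ℝ x) x := by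
  have hint : HasFDerivAt (fun x => ∫ y, Real.log (1 + ‖x‖ ^ 2 / ‖y‖ ^ 2) * σ y ∂μ)
      (∫ y, (2 * (σ y / (‖y‖ ^ 2 + ‖x‖ ^ 2))) • innerSL ℝ x ∂μ) x := by
    refine hasFDerivAt_integral_of_dominated_of_fderiv_le
      (F' := fun z y => (2 * (σ y / (‖y‖ ^ 2 + ‖z‖ ^ 2))) • innerSL ℝ z)
      (bound := fun y => |σ y|) univ_mem
      (Eventually.of_forall fun z => (hσ.integrable_log_mul z).1) (hσ.integrable_log_mul x)
      ((hσ.integrable_div x).const_mul 2 |>.smul_const _).1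
      (Eventually.of_forall fun y z _ => ?_) hσ.integrable.abs
      (Eventually.of_forall fun y z _ => ?_)
    · by_cases h0 : σ y = 0
      · simp [h0]
      have hy := hσ.ne_zero h0
      have hp : 0 < ‖y‖ ^ 2 + ‖z‖ ^ 2 := by positivity
      rw [norm_smul, innerSL_apply_norm, norm_mul, norm_div, Real.norm_eq_abs, Real.norm_eq_abs,
        Real.norm_eq_abs, abs_of_pos hp, abs_two, mul_div_assoc', div_mul_eq_mul_div,
        div_le_iff₀ hp]
      have : 2 * ‖z‖ ≤ ‖y‖ ^ 2 + ‖z‖ ^ 2 := by nlinarith [sq_nonneg (‖y‖ - ‖z‖), norm_nonneg z]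
      nlinarith [abs_nonneg (σ y)]
    · by_cases h0 : σ y = 0
      · simpa [h0] using hasFDerivAt_const (0 : ℝ) z
      have hy := hσ.ne_zero h0
      have := (hasFDerivAt_log_one_add_norm_sq (s := ‖y‖ ^ 2) (by positivity) z).mul_const (σ y)
      refine this.congr_fderiv ?_
      rw [smul_smul]
      congr 1
      ring
  have h1 := hasFDerivAt_log_one_add_norm_sq one_pos x
  simp only [div_one] at h1
  have := (h1.const_mul (-(a / 2))).sub (hint.const_mul (1 / 2))
  refine this.congr_fderiv ?_
  rw [integral_smul_const, integral_const_mul, smul_smul, smul_smul, ← sub_smul, initSlope]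
  congr 1
  ring

lemma IsTailDensity.initSlope_bounds (hσ : IsTailDensity μ σ) (a : ℝ) (x : E) :
    |initSlope μ σ a x| * ‖x‖ ^ 2 ≤ |a| + ∫ y, |σ y| ∂μ ∧
      initSlope μ σ a x * ‖x‖ ^ 2 ≤ max a 0 + ∫ y, |σ y| ∂μ := by
  have h1 : |∫ y, σ y / (‖y‖ ^ 2 + ‖x‖ ^ 2) ∂μ| * ‖x‖ ^ 2 ≤ ∫ y, |σ y| ∂μ := by
    calc _ ≤ (∫ y, |σ y / (‖y‖ ^ 2 + ‖x‖ ^ 2)| ∂μ) * ‖x‖ ^ 2 := by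
          gcongr
          exact abs_integral_le_integral_abs
      _ = ∫ y, |σ y / (‖y‖ ^ 2 + ‖x‖ ^ 2)| * ‖x‖ ^ 2 ∂μ := (integral_mul_const _ _).symm
      _ ≤ _ := integral_mono ((hσ.integrable_div x).abs.mul_const _) hσ.integrable.abs
          fun y => (hσ.abs_div_le x y).2
  have hp : 0 < 1 + ‖x‖ ^ 2 := by positivity
  have h2 : ∀ b : ℝ, 0 ≤ b → b / (1 + ‖x‖ ^ 2) * ‖x‖ ^ 2 ≤ b := fun b hb => by
    rw [div_mul_eq_mul_div, div_le_iff₀ hp]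
    gcongr
    linarith
  constructor
  · calc _ ≤ (|a| / (1 + ‖x‖ ^ 2) + |∫ y, σ y / (‖y‖ ^ 2 + ‖x‖ ^ 2) ∂μ|) * ‖x‖ ^ 2 := by
          gcongr
          refine (abs_add_le _ _).trans_eq ?_
          rw [abs_div, abs_of_pos hp]
      _ ≤ _ := by
          rw [add_mul]
          exact add_le_add (h2 _ (abs_nonneg a)) h1
  · calc _ ≤ (max a 0 / (1 + ‖x‖ ^ 2) + |∫ y, σ y / (‖y‖ ^ 2 + ‖x‖ ^ 2) ∂μ|) * ‖x‖ ^ 2 := by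
          unfold initSlope
          gcongr
          · exact le_max_left _ _
          · exact le_abs_self _
      _ ≤ _ := by
          rw [add_mul]
          exact add_le_add (h2 _ (le_max_right _ _)) h1

lemma IsTailDensity.hasFDerivAt_initMap (hσ : IsTailDensity μ σ) (a : ℝ) (x : E) :
    HasFDerivAt (initMap μ σ a) (Real.exp (initPot μ σ a x) • (ContinuousLinearMap.id ℝ E -
      initSlope μ σ a x • (innerSL ℝ x).smulRight x)) x := by
  have := (hσ.hasFDerivAt_initPot a x).exp.smul (hasFDerivAt_id x)
  refine this.congr_fderiv ?_
  ext1 w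
  simp only [add_apply, smul_apply, ContinuousLinearMap.id_apply, sub_apply,
    ContinuousLinearMap.smulRight_apply, id_eq, smul_eq_mul]
  module

lemma IsTailDensity.normalized_fderiv_initMap (hσ : IsTailDensity μ σ) (a : ℝ) (x : E) :
    Real.exp (-initPot μ σ a x) • fderiv ℝ (initMap μ σ a) x = ContinuousLinearMap.id ℝ E -
      initSlope μ σ a x • (innerSL ℝ x).smulRight x := by
  rw [(hσ.hasFDerivAt_initMap a x).fderiv, smul_smul, ← Real.exp_add, neg_add_cancel, Real.exp_zero,
    one_smul]

lemma IsTailDensity.isFlowStart (hσ : IsTailDensity μ σ) (a : ℝ) {T : ℝ}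
    (hT : |a| + ∫ y, |σ y| ∂μ ≤ T) : IsFlowStart (initPot μ σ a) (initMap μ σ a) T (1 + T) where
  differentiable_pot x := (hσ.hasFDerivAt_initPot a x).differentiableAt
  differentiable_map x := (hσ.hasFDerivAt_initMap a x).differentiableAt
  norm_fderiv_pot x := by
    have := (hσ.initSlope_bounds a x).1
    rw [(hσ.hasFDerivAt_initPot a x).fderiv, norm_smul, innerSL_apply_norm, norm_neg,
      Real.norm_eq_abs]
    nlinarith
  norm_fderiv_map x := by
    have := (hσ.initSlope_bounds a x).1
    rw [hσ.normalized_fderiv_initMap]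
    refine (norm_sub_le _ _).trans (add_le_add ContinuousLinearMap.norm_id_le ?_)
    rw [norm_smul, ContinuousLinearMap.norm_smulRight_apply, innerSL_apply_norm, Real.norm_eq_abs]
    nlinarith
  norm_map x := by
    rw [initMap, norm_smul, Real.norm_eq_abs, abs_of_pos (Real.exp_pos _)]

lemma IsTailDensity.inner_normalized_fderiv_initMap (hσ : IsTailDensity μ σ) (a : ℝ) (x w : E) :
    (1 - (max a 0 + ∫ y, |σ y| ∂μ)) * ‖w‖ ^ 2 ≤
      inner ℝ ((Real.exp (-initPot μ σ a x) • fderiv ℝ (initMap μ σ a) x) w) w := by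
  have h1 := (hσ.initSlope_bounds a x).2
  have h2 : 0 ≤ max a 0 + ∫ y, |σ y| ∂μ :=
    add_nonneg (le_max_right _ _) (integral_nonneg fun _ => abs_nonneg _)
  have h3 : (inner ℝ x w) ^ 2 ≤ ‖x‖ ^ 2 * ‖w‖ ^ 2 := by
    rw [← mul_pow, ← sq_abs]
    exact pow_le_pow_left₀ (abs_nonneg _) (abs_real_inner_le_norm x w) 2
  rw [hσ.normalized_fderiv_initMap]
  simp only [sub_apply, ContinuousLinearMap.id_apply,
    smul_apply, ContinuousLinearMap.smulRight_apply, innerSL_apply_apply,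
    inner_sub_left, real_inner_smul_left, real_inner_self_eq_norm_sq]
  have h4 : initSlope μ σ a x * (inner ℝ x w) ^ 2 ≤
      (max a 0 + ∫ y, |σ y| ∂μ) * ‖w‖ ^ 2 := by
    rcases le_total (initSlope μ σ a x) 0 with h | h
    · exact (mul_nonpos_of_nonpos_of_nonneg h (sq_nonneg _)).trans (by positivity)
    · calc _ ≤ initSlope μ σ a x * (‖x‖ ^ 2 * ‖w‖ ^ 2) := by gcongr
        _ = (initSlope μ σ a x * ‖x‖ ^ 2) * ‖w‖ ^ 2 := by ring
        _ ≤ _ := by gcongr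
  nlinarith

lemma IsTailDensity.le_initPot (hσ : IsTailDensity μ σ) (a : ℝ) (x : E) :
    -((max a 0 + ∫ y, |σ y| ∂μ) / 2 * Real.log (1 + ‖x‖ ^ 2)) ≤ initPot μ σ a x := by
  have h0 : 0 ≤ Real.log (1 + ‖x‖ ^ 2) := by simpa using log_one_add_nonneg zero_le_one x
  have h1 : ∫ y, Real.log (1 + ‖x‖ ^ 2 / ‖y‖ ^ 2) * σ y ∂μ ≤
      Real.log (1 + ‖x‖ ^ 2) * ∫ y, |σ y| ∂μ := by
    rw [← integral_const_mul]
    exact integral_mono (hσ.integrable_log_mul x) (hσ.integrable.abs.const_mul _) fun y =>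
      (le_abs_self _).trans (hσ.norm_log_mul_le x y)
  have h2 : a * Real.log (1 + ‖x‖ ^ 2) ≤ max a 0 * Real.log (1 + ‖x‖ ^ 2) := by
    gcongr
    exact le_max_left _ _
  unfold initPot
  linarith

lemma IsTailDensity.tendsto_norm_initMap (hσ : IsTailDensity μ σ) {a : ℝ}
    (ha : max a 0 + ∫ y, |σ y| ∂μ < 1) :
    Tendsto (fun x => ‖initMap μ σ a x‖) (cocompact E) atTop := by
  set β := max a 0 + ∫ y, |σ y| ∂μ with hβ
  have hβ0 : 0 ≤ β := add_nonneg (le_max_right _ _) (integral_nonneg fun _ => abs_nonneg _)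
  have hlim : Tendsto (fun x : E => Real.exp ((1 - β) * Real.log ‖x‖ + -(β / 2 * Real.log 2)))
      (cocompact E) atTop :=
    Real.tendsto_exp_atTop.comp (tendsto_atTop_add_const_right _ _
      ((Real.tendsto_log_atTop.comp tendsto_norm_cocompact_atTop).const_mul_atTop
        (by linarith)))
  refine tendsto_atTop_mono' _ ?_ hlim
  filter_upwards [tendsto_norm_cocompact_atTop.eventually_ge_atTop 1] with x hx
  have hx0 : 0 < ‖x‖ := by linarith
  have h1 := hσ.le_initPot a x
  have h2 : Real.log (1 + ‖x‖ ^ 2) ≤ Real.log 2 + 2 * Real.log ‖x‖ := by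
    have e : Real.log 2 + 2 * Real.log ‖x‖ = Real.log (2 * ‖x‖ ^ 2) := by
      rw [Real.log_mul (by norm_num) (by positivity), Real.log_pow]
      norm_num
    rw [e]
    gcongr
    nlinarith
  rw [initMap, norm_smul, Real.norm_eq_abs, abs_of_pos (Real.exp_pos _)]
  nth_rewrite 2 [← Real.exp_log hx0]
  rw [← Real.exp_add]
  refine Real.exp_le_exp.2 ?_
  have h3 : β / 2 * Real.log (1 + ‖x‖ ^ 2) ≤ β / 2 * (Real.log 2 + 2 * Real.log ‖x‖) := by gcongr
  rw [← hβ] at h1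
  linarith

end InitialMap

section Comparison

variable {E : Type*} [NormedAddCommGroup E] [InnerProductSpace ℝ E] [FiniteDimensional ℝ E]
  [MeasurableSpace E] [BorelSpace E] {μ : Measure E} {σ : E → ℝ}

lemma integrableOn_log_norm [Nontrivial E] [μ.IsAddHaarMeasure] (r : ℝ) :
    IntegrableOn (fun y : E => Real.log ‖y‖) (ball 0 r) μ := by
  rw [integrableOn_fun_norm_addHaar μ (f := Real.log)]
  have h : IntervalIntegrable (fun y : ℝ => y ^ (Module.finrank ℝ E - 1) • Real.log y) volume 0 r :=
    intervalIntegral.intervalIntegrable_log'.continuousOn_mul (by fun_prop)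
  exact h.1.mono_set Ioo_subset_Ioc_self

lemma integrable_tsum_of_summable_integral_norm {F : ℕ → E → ℝ} (hF : ∀ k, Integrable (F k) μ)
    (hs : Summable fun k => ∫ y, ‖F k y‖ ∂μ) (hp : ∀ᵐ y ∂μ, Summable fun k => F k y) :
    Integrable (fun y => ∑' k, F k y) μ := by
  have hm : AEStronglyMeasurable (fun y => ∑' k, F k y) μ :=
    aestronglyMeasurable_of_tendsto_ae atTop
      (f := fun N y => ∑ k ∈ Finset.range N, F k y)
      (fun N => (integrable_finsetSum _ fun k _ => hF k).1)
      (hp.mono fun y hy => hy.hasSum.tendsto_sum_nat)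
  refine ⟨hm, ?_⟩
  calc ∫⁻ y, ‖∑' k, F k y‖ₑ ∂μ ≤ ∫⁻ y, ∑' k, ‖F k y‖ₑ ∂μ := by
        refine lintegral_mono_ae (hp.mono fun y hy => enorm_tsum_le_tsum_enorm)
    _ = ∑' k, ∫⁻ y, ‖F k y‖ₑ ∂μ := lintegral_tsum fun k => (hF k).1.enorm
    _ = ∑' k, ENNReal.ofReal (∫ y, ‖F k y‖ ∂μ) := by
        congr 1
        ext k
        rw [ofReal_integral_norm_eq_lintegral_enorm (hF k)]
    _ < ⊤ := hs.tsum_ofReal_lt_top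

lemma log_le_log_add {a b : ℝ} (ha : 0 < a) (hb : 0 < b) (n : ℕ) (h : a ≤ 2 ^ n * b) :
    Real.log a ≤ Real.log b + n := by
  have h1 : Real.log a ≤ n * Real.log 2 + Real.log b := by
    rw [← Real.log_pow, ← Real.log_mul (by positivity) hb.ne']
    exact Real.log_le_log ha h
  have h2 : Real.log 2 ≤ 1 := by
    have := Real.log_two_lt_d9
    linarith
  have h3 : (0 : ℝ) ≤ n := n.cast_nonneg
  nlinarith

lemma abs_log_kernel_near_le {x y : E} (hy : y ≠ 0) (hxy : 2 * ‖y‖ ≤ ‖x‖) (hx : 1 ≤ ‖x‖) :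
    |Real.log (‖y‖ / ‖x - y‖) + 1 / 2 * Real.log (1 + ‖x‖ ^ 2)| ≤ |Real.log ‖y‖| + 2 := by
  have h1 : ‖x‖ - ‖y‖ ≤ ‖x - y‖ := norm_sub_norm_le x y
  have h2 : ‖x - y‖ ≤ ‖x‖ + ‖y‖ := norm_sub_le x y
  have hy' : 0 < ‖y‖ := norm_pos_iff.2 hy
  have hd : 0 < ‖x - y‖ := by linarith
  have h3 : Real.log (‖x - y‖ ^ 2) ≤ Real.log (1 + ‖x‖ ^ 2) + 4 := by
    exact_mod_cast log_le_log_add (by positivity) (by positivity) 4 (by nlinarith)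
  have h4 : Real.log (1 + ‖x‖ ^ 2) ≤ Real.log (‖x - y‖ ^ 2) + 4 := by
    exact_mod_cast log_le_log_add (by positivity) (by positivity) 4 (by nlinarith)
  rw [Real.log_pow] at h3 h4
  push_cast at h3 h4
  rw [Real.log_div hy'.ne' hd.ne']
  have h5 := abs_le.1 (le_refl |Real.log ‖y‖|)
  rw [abs_le]
  constructor <;> linarith

lemma abs_log_kernel_far_le {x y : E} (hy : y ≠ 0) (hxy : x ≠ y) :
    |Real.log (‖y‖ / ‖x - y‖) + 1 / 2 * Real.log (1 + ‖x‖ ^ 2 / ‖y‖ ^ 2) -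
      Real.log 2 * ∑' k, bump k x y| ≤ 6 := by
  obtain ⟨K, hK, hK'⟩ := exists_bump_sum x y hxy hy
  rw [tsum_eq_sum (s := Finset.range K) fun k hk => hK k (not_lt.1 (by simpa using hk))]
  have hy' : 0 < ‖y‖ := norm_pos_iff.2 hy
  have hd : 0 < ‖x - y‖ := norm_pos_iff.2 (sub_ne_zero.2 hxy)
  have h1 : ‖x‖ ≤ ‖x - y‖ + ‖y‖ := by
    have := norm_add_le (x - y) y
    rwa [sub_add_cancel] at this
  have h2 : ‖x - y‖ ≤ ‖x‖ + ‖y‖ := norm_sub_le x y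
  rw [← div_pow]
  set t := ‖x - y‖ / ‖y‖ with ht
  set s := ‖x‖ / ‖y‖ with hs
  have ht0 : 0 < t := by positivity
  have hs0 : 0 ≤ s := by positivity
  have hst : s ≤ t + 1 := by
    rw [hs, ht, ← div_self hy'.ne', ← add_div]
    gcongr
  have hts : t ≤ s + 1 := by
    rw [hs, ht, ← div_self hy'.ne', ← add_div]
    gcongr
  have hinv : ‖y‖ / ‖x - y‖ = t⁻¹ := by rw [ht, inv_div]
  rw [hinv, Real.log_inv] at hK' ⊢
  have key : |max (-Real.log t) 0 - (-Real.log t) - 1 / 2 * Real.log (1 + s ^ 2)| ≤ 2 := by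
    rcases le_total t 1 with h | h
    · have h3 := Real.log_nonpos ht0.le h
      have h4 : 0 ≤ Real.log (1 + s ^ 2) := Real.log_nonneg (by nlinarith)
      have h5 : Real.log (1 + s ^ 2) ≤ Real.log 1 + 4 := by
        exact_mod_cast log_le_log_add (by positivity) one_pos 4 (by nlinarith)
      rw [Real.log_one] at h5
      rw [max_eq_left (by linarith), abs_le]
      constructor <;> linarith
    · have h3 := Real.log_nonneg h
      have h4 : Real.log (1 + s ^ 2) ≤ Real.log (t ^ 2) + 4 := by
        exact_mod_cast log_le_log_add (by positivity) (by positivity) 4 (by nlinarith)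
      have h5 : Real.log (t ^ 2) ≤ Real.log (1 + s ^ 2) + 4 := by
        exact_mod_cast log_le_log_add (by positivity) (by positivity) 4
          (by nlinarith [sq_nonneg (s - 1)])
      rw [Real.log_pow] at h4 h5
      push_cast at h4 h5
      rw [max_eq_right (by linarith), abs_le]
      constructor <;> linarith
  rw [abs_le] at key hK' ⊢
  constructor <;> linarith [key.1, key.2, hK'.1, hK'.2]

lemma IsTailDensity.const_mul (hσ : IsTailDensity μ σ) (c : ℝ) :
    IsTailDensity μ fun y => c * σ y where
  integrable := hσ.integrable.const_mul c
  eq_zero y hy := by rw [hσ.eq_zero y hy, mul_zero]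
  locallyBounded r := by
    obtain ⟨M, hM⟩ := hσ.locallyBounded r
    refine ⟨|c| * M, fun y hy => ?_⟩
    rw [abs_mul]
    gcongr
    exact hM y hy

lemma isTailDensity_indicator {ρ₀ : E → ℝ} (hc : Continuous ρ₀) (hi : Integrable ρ₀ μ) {R : ℝ}
    (hR : 1 ≤ R) : IsTailDensity μ ((closedBall 0 R)ᶜ.indicator ρ₀) where
  integrable := hi.indicator measurableSet_closedBall.compl
  eq_zero y hy := indicator_of_notMem (by simpa using hy.trans hR) _
  locallyBounded r := by
    obtain ⟨M, hM⟩ := (isCompact_closedBall (0 : E) r).exists_bound_of_continuousOn hc.continuousOn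
    refine ⟨M, fun y hy => le_trans ?_ (hM y (by simpa using hy))⟩
    rw [← Real.norm_eq_abs]
    exact norm_indicator_le_norm_self _ _

lemma IsTailDensity.summable_integral_norm_bump [Nontrivial E] [μ.IsAddHaarMeasure]
    (hσ : IsTailDensity μ σ) (x : E) : Summable fun k => ∫ y, ‖bump k x y * σ y‖ ∂μ := by
  obtain ⟨D, hD0, hD⟩ := hσ.exists_scaleMass_decay ‖x‖
  refine Summable.of_nonneg_of_le (fun k => integral_nonneg fun _ => norm_nonneg _) (fun k => ?_)
    ((summable_geometric_of_lt_one (r := (1 / 2 : ℝ)) (by norm_num) (by norm_num)).mul_left D)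
  rw [one_div_pow, mul_one_div]
  refine le_trans (le_of_eq ?_) (hD k x le_rfl).1
  simp [abs_of_nonneg (bump_nonneg k x _)]

lemma IsTailDensity.integrable_bump_mul (hσ : IsTailDensity μ σ) (k : ℕ) (x : E) :
    Integrable (fun y => bump k x y * σ y) μ := by
  simpa using hσ.integrable_cut k (continuous_const (y := (1 : ℝ))) x

lemma IsTailDensity.summable_bump_mul (hσ : IsTailDensity μ σ) {x y : E} (hxy : x ≠ y) :
    Summable fun k => bump k x y * σ y := by
  by_cases h0 : σ y = 0
  · simp [h0]
  obtain ⟨K, hK, -⟩ := exists_bump_sum x y hxy (hσ.ne_zero' h0)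
  refine (summable_of_ne_finset_zero (s := Finset.range K) fun k hk =>
    hK k (not_lt.1 (by simpa using hk))).mul_right _

lemma ae_ne [Nontrivial E] [μ.IsAddHaarMeasure] (x : E) : ∀ᵐ y ∂μ, x ≠ y := by
  filter_upwards [compl_mem_ae_iff.2 (measure_singleton (μ := μ) x)] with y hy
  exact fun h => hy h.symm

lemma IsTailDensity.integrable_tsum_bump [Nontrivial E] [μ.IsAddHaarMeasure]
    (hσ : IsTailDensity μ σ) (x : E) : Integrable (fun y => ∑' k, bump k x y * σ y) μ :=
  integrable_tsum_of_summable_integral_norm (fun k => hσ.integrable_bump_mul k x)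
    (hσ.summable_integral_norm_bump x) ((ae_ne x).mono fun _ hy => hσ.summable_bump_mul hy)

lemma IsTailDensity.tsum_scaleMass [Nontrivial E] [μ.IsAddHaarMeasure]
    (hσ : IsTailDensity μ σ) (x : E) :
    ∑' k, scaleMass μ σ k x = ∫ y, ∑' k, bump k x y * σ y ∂μ := by
  rw [← integral_tsum_of_summable_integral_norm (fun k => hσ.integrable_bump_mul k x)
    (hσ.summable_integral_norm_bump x)]
  simp [scaleMass, cutInt]

lemma abs_potential_sub_far_le [Nontrivial E] [μ.IsAddHaarMeasure] {ρ₀ : E → ℝ}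
    (hc : Continuous ρ₀) (hi : Integrable ρ₀ μ) {R : ℝ} (hR : 1 ≤ R) {x : E} (hx : 2 * R ≤ ‖x‖) :
    |(∫ y, Real.log (‖y‖ / ‖x - y‖) * ρ₀ y ∂μ) - limitPot μ
      (fun y => Real.log 2 * (closedBall 0 R)ᶜ.indicator ρ₀ y)
      (initPot μ ((closedBall 0 R)ᶜ.indicator ρ₀) (∫ y in closedBall 0 R, ρ₀ y ∂μ)) x| ≤
    ∫ y, (closedBall 0 R).indicator (fun y => |Real.log ‖y‖| * |ρ₀ y|) y + 6 * |ρ₀ y| ∂μ := by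
  set σ := (closedBall 0 R)ᶜ.indicator ρ₀ with hσdef
  have hσ : IsTailDensity μ σ := isTailDensity_indicator hc hi hR
  have hρ := hσ.const_mul (Real.log 2)
  set ι := (closedBall (0 : E) R).indicator ρ₀ with hι
  have hιi : Integrable ι μ := hi.indicator measurableSet_closedBall
  set e : E → ℝ := fun y => Real.log (‖y‖ / ‖x - y‖) * ρ₀ y +
    1 / 2 * Real.log (1 + ‖x‖ ^ 2) * ι y + 1 / 2 * (Real.log (1 + ‖x‖ ^ 2 / ‖y‖ ^ 2) * σ y) -
      ∑' k, bump k x y * (Real.log 2 * σ y) with he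
  have hi1 : Integrable (fun y => 1 / 2 * Real.log (1 + ‖x‖ ^ 2) * ι y) μ := hιi.const_mul _
  have hi2 : Integrable (fun y => 1 / 2 * (Real.log (1 + ‖x‖ ^ 2 / ‖y‖ ^ 2) * σ y)) μ :=
    (hσ.integrable_log_mul x).const_mul _
  have hi3 := hρ.integrable_tsum_bump x
  have hbi : Integrable (fun y => (closedBall 0 R).indicator
      (fun y => |Real.log ‖y‖| * |ρ₀ y|) y + 6 * |ρ₀ y|) μ := by
    refine Integrable.add ?_ (hi.abs.const_mul 6)
    rw [integrable_indicator_iff measurableSet_closedBall]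
    have hl : IntegrableOn (fun y : E => |Real.log ‖y‖|) (closedBall 0 R) μ :=
      Integrable.abs ((integrableOn_log_norm (R + 1)).mono_set
        (closedBall_subset_ball (lt_add_one R)))
    exact hl.mul_continuousOn hc.abs.continuousOn (isCompact_closedBall _ _)
  have hbound : ∀ᵐ y ∂μ, ‖e y‖ ≤ (closedBall 0 R).indicator
      (fun y => |Real.log ‖y‖| * |ρ₀ y|) y + 6 * |ρ₀ y| := by
    filter_upwards [ae_ne x, ae_ne (μ := μ) (0 : E)] with y hxy hy
    rw [Real.norm_eq_abs]
    by_cases hyR : y ∈ closedBall (0 : E) R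
    · have h1 : σ y = 0 := indicator_of_notMem (by simpa using hyR) _
      have h2 : ι y = ρ₀ y := indicator_of_mem hyR _
      have hyR' : ‖y‖ ≤ R := by simpa using hyR
      have h3 := abs_log_kernel_near_le (x := x) hy.symm (by linarith) (by linarith)
      rw [indicator_of_mem hyR, he]
      simp only [h1, h2, mul_zero, tsum_zero, add_zero, sub_zero]
      rw [← add_mul, abs_mul]
      nlinarith [abs_nonneg (ρ₀ y)]
    · have h1 : σ y = ρ₀ y := indicator_of_mem hyR _
      have h2 : ι y = 0 := indicator_of_notMem hyR _
      have h3 := abs_log_kernel_far_le hy.symm hxy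
      rw [indicator_of_notMem hyR, he]
      simp only [h1, h2, mul_zero, add_zero, tsum_mul_right, zero_add]
      calc _ = |Real.log (‖y‖ / ‖x - y‖) + 1 / 2 * Real.log (1 + ‖x‖ ^ 2 / ‖y‖ ^ 2) -
            Real.log 2 * ∑' k, bump k x y| * |ρ₀ y| := by rw [← abs_mul]; congr 1; ring
        _ ≤ _ := by gcongr
  have hm : Measurable fun y : E => Real.log (‖y‖ / ‖x - y‖) := by fun_prop
  have hei : Integrable e μ := hbi.mono'
    ((((hm.aestronglyMeasurable.mul hi.1).add hi1.1).add hi2.1).sub hi3.1) hbound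
  have heq : (∫ y, Real.log (‖y‖ / ‖x - y‖) * ρ₀ y ∂μ) =
      (∫ y, e y ∂μ) - (∫ y, 1 / 2 * Real.log (1 + ‖x‖ ^ 2) * ι y ∂μ) -
        (∫ y, 1 / 2 * (Real.log (1 + ‖x‖ ^ 2 / ‖y‖ ^ 2) * σ y) ∂μ) +
        ∫ y, ∑' k, bump k x y * (Real.log 2 * σ y) ∂μ := by
    have hj1 : Integrable (fun y => e y - 1 / 2 * Real.log (1 + ‖x‖ ^ 2) * ι y) μ := hei.sub hi1
    have hj2 : Integrable (fun y => e y - 1 / 2 * Real.log (1 + ‖x‖ ^ 2) * ι y -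
      1 / 2 * (Real.log (1 + ‖x‖ ^ 2 / ‖y‖ ^ 2) * σ y)) μ := hj1.sub hi2
    rw [← integral_sub hei hi1, ← integral_sub hj1 hi2, ← integral_add hj2 hi3]
    congr 1
    ext y
    rw [he]
    ring
  have hpot : (∫ y, Real.log (‖y‖ / ‖x - y‖) * ρ₀ y ∂μ) - limitPot μ
      (fun y => Real.log 2 * σ y) (initPot μ σ (∫ y in closedBall 0 R, ρ₀ y ∂μ)) x =
      ∫ y, e y ∂μ := by
    rw [heq, limitPot, initPot, hρ.tsum_scaleMass, integral_const_mul, integral_const_mul, hι,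
      integral_indicator measurableSet_closedBall]
    ring
  rw [hpot, ← Real.norm_eq_abs]
  exact norm_integral_le_of_norm_le hbi hbound

theorem exists_abs_potential_sub_le [Nontrivial E] [μ.IsAddHaarMeasure] {ρ₀ : E → ℝ}
    (hc : Continuous ρ₀) (hi : Integrable ρ₀ μ) {R : ℝ} (hR : 1 ≤ R)
    (hw : Continuous fun x => ∫ y, Real.log (‖y‖ / ‖x - y‖) * ρ₀ y ∂μ) :
    ∃ M : ℝ, ∀ x, |(∫ y, Real.log (‖y‖ / ‖x - y‖) * ρ₀ y ∂μ) - limitPot μ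
      (fun y => Real.log 2 * (closedBall 0 R)ᶜ.indicator ρ₀ y)
      (initPot μ ((closedBall 0 R)ᶜ.indicator ρ₀) (∫ y in closedBall 0 R, ρ₀ y ∂μ)) x| ≤ M := by
  have hσ : IsTailDensity μ ((closedBall 0 R)ᶜ.indicator ρ₀) := isTailDensity_indicator hc hi hR
  obtain ⟨M₁, hM₁⟩ := (hσ.const_mul (Real.log 2)).exists_tsum_scaleMass_le (2 * R)
  have hv : Continuous (initPot μ ((closedBall 0 R)ᶜ.indicator ρ₀)
      (∫ y in closedBall 0 R, ρ₀ y ∂μ)) :=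
    continuous_iff_continuousAt.2 fun x => (hσ.hasFDerivAt_initPot _ x).continuousAt
  obtain ⟨M₂, hM₂⟩ := (isCompact_closedBall (0 : E) (2 * R)).exists_bound_of_continuousOn
    (hw.sub hv).continuousOn
  refine ⟨max (M₂ + M₁) (∫ y, (closedBall 0 R).indicator
    (fun y => |Real.log ‖y‖| * |ρ₀ y|) y + 6 * |ρ₀ y| ∂μ), fun x => ?_⟩
  rcases le_total ‖x‖ (2 * R) with hx | hx
  · refine le_trans ?_ (le_max_left _ _)
    rw [limitPot, ← sub_sub]
    exact (abs_sub _ _).trans (add_le_add (hM₂ x (by simpa using hx)) (hM₁ x hx))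
  · exact (abs_potential_sub_far_le hc hi hR hx).trans (le_max_right _ _)

end Comparison

section Conclusion

variable {E : Type*} [NormedAddCommGroup E] [InnerProductSpace ℝ E] [FiniteDimensional ℝ E]

/-- `F` is differentiable and its derivative, divided by `exp U`, is bounded by `B` and accretive
with constant `c`. -/
structure IsAccretiveMap (U : E → ℝ) (F : E → E) (B c : ℝ) : Prop where
  differentiable : Differentiable ℝ F
  pos : 0 < c
  norm_le : ∀ x, ‖Real.exp (-U x) • fderiv ℝ F x‖ ≤ B
  inner_ge : ∀ x w, c * ‖w‖ ^ 2 ≤ inner ℝ ((Real.exp (-U x) • fderiv ℝ F x) w) w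

variable {U : E → ℝ} {F : E → E} {B c : ℝ}

lemma mul_norm_le_of_inner {N : E →L[ℝ] E} (hN : ∀ w, c * ‖w‖ ^ 2 ≤ inner ℝ (N w) w) (w : E) :
    c * ‖w‖ ≤ ‖N w‖ := by
  rcases (norm_nonneg w).eq_or_lt with h | h
  · rw [← h, mul_zero]
    exact norm_nonneg _
  · have := (hN w).trans (real_inner_le_norm (N w) w)
    nlinarith

namespace IsAccretiveMap

lemma inner_fderiv_ge (h : IsAccretiveMap U F B c) (x w : E) :
    c * Real.exp (U x) * ‖w‖ ^ 2 ≤ inner ℝ (fderiv ℝ F x w) w := by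
  have h1 := h.inner_ge x w
  rw [smul_apply, real_inner_smul_left, Real.exp_neg] at h1
  have h2 := Real.exp_pos (U x)
  calc c * Real.exp (U x) * ‖w‖ ^ 2 = Real.exp (U x) * (c * ‖w‖ ^ 2) := by ring
    _ ≤ Real.exp (U x) * ((Real.exp (U x))⁻¹ * inner ℝ (fderiv ℝ F x w) w) := by gcongr
    _ = _ := by rw [mul_inv_cancel_left₀ h2.ne']

lemma norm_fderiv_ge (h : IsAccretiveMap U F B c) (x w : E) :
    c * Real.exp (U x) * ‖w‖ ≤ ‖fderiv ℝ F x w‖ :=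
  mul_norm_le_of_inner (h.inner_fderiv_ge x) w

lemma norm_fderiv_le (h : IsAccretiveMap U F B c) (x w : E) :
    ‖fderiv ℝ F x w‖ ≤ B * Real.exp (U x) * ‖w‖ := by
  have h1 := h.norm_le x
  rw [norm_smul, Real.norm_eq_abs, Real.abs_exp, Real.exp_neg, inv_mul_le_iff₀ (Real.exp_pos _)]
    at h1
  refine ((fderiv ℝ F x).le_opNorm w).trans ?_
  gcongr
  linarith

lemma injective_fderiv (h : IsAccretiveMap U F B c) (x : E) :
    Function.Injective (fderiv ℝ F x) := by
  rw [injective_iff_map_eq_zero]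
  intro w hw
  have h1 := h.norm_fderiv_ge x w
  rw [hw, norm_zero] at h1
  have h2 : 0 < c * Real.exp (U x) := mul_pos h.pos (Real.exp_pos _)
  exact norm_eq_zero.1 (le_antisymm (by nlinarith) (norm_nonneg w))

lemma injective (h : IsAccretiveMap U F B c) : Function.Injective F := by
  intro x y hxy
  by_contra hne
  have hw : 0 < ‖x - y‖ := norm_pos_iff.2 (sub_ne_zero.2 hne)
  have hd : ∀ t : ℝ, HasDerivAt (fun t : ℝ => inner ℝ (F (y + t • (x - y))) (x - y))
      (inner ℝ (fderiv ℝ F (y + t • (x - y)) (x - y)) (x - y)) t := by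
    intro t
    have h1 : HasDerivAt (fun t : ℝ => y + t • (x - y)) (x - y) t := by
      simpa using ((hasDerivAt_id t).smul_const (x - y)).const_add y
    simpa using (((h.differentiable _).hasFDerivAt.comp_hasDerivAt t h1).inner ℝ
      (hasDerivAt_const t (x - y)))
  have hm : StrictMono fun t : ℝ => inner ℝ (F (y + t • (x - y))) (x - y) := by
    refine strictMono_of_deriv_pos fun t => ?_
    rw [(hd t).deriv]
    exact lt_of_lt_of_le (by have := h.pos; positivity) (h.inner_fderiv_ge _ _)
  have := hm one_pos
  simp [hxy] at this

lemma surjective (h : IsAccretiveMap U F B c)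
    (hF : Tendsto (fun x => ‖F x‖) (cocompact E) atTop) : Function.Surjective F := by
  intro z
  have hcont : Continuous fun x => ‖F x - z‖ ^ 2 := by
    have := h.differentiable.continuous
    fun_prop
  have hlim : Tendsto (fun x => ‖F x - z‖ ^ 2) (cocompact E) atTop := by
    refine (tendsto_pow_atTop two_ne_zero).comp ?_
    refine tendsto_atTop_mono (fun x => ?_) (tendsto_atTop_add_const_right _ (-‖z‖) hF)
    have := norm_sub_norm_le (F x) z
    linarith
  obtain ⟨x, hx⟩ := hcont.exists_forall_le hlim
  have h0 : (2 • (innerSL ℝ (F x - z)) ∘L fderiv ℝ F x) = 0 :=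
    IsLocalMin.hasFDerivAt_eq_zero (Eventually.of_forall hx)
      ((h.differentiable x).hasFDerivAt.sub_const z).norm_sq
  obtain ⟨w, hw⟩ := LinearMap.surjective_of_injective (f := (fderiv ℝ F x : E →ₗ[ℝ] E))
    (h.injective_fderiv x) (F x - z)
  have h1 := congrArg (fun L : E →L[ℝ] ℝ => L w) h0
  have hw' : fderiv ℝ F x w = F x - z := hw
  simp only [smul_apply, ContinuousLinearMap.comp_apply, hw', innerSL_apply_apply,
    zero_apply, smul_eq_zero, OfNat.ofNat_ne_zero, false_or, inner_self_eq_zero] at h1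
  exact ⟨x, sub_eq_zero.1 h1⟩

/-- A proper accretive map is a homeomorphism. -/
def homeomorph (h : IsAccretiveMap U F B c)
    (hF : Tendsto (fun x => ‖F x‖) (cocompact E) atTop) : E ≃ₜ E :=
  (Equiv.ofBijective F ⟨h.injective, h.surjective hF⟩).toHomeomorphOfContinuousClosed
    h.differentiable.continuous
    (isProperMap_iff_tendsto_cocompact.2 ⟨h.differentiable.continuous, by
      rw [← Metric.cobounded_eq_cocompact (α := E), ← tendsto_norm_atTop_iff_cobounded,
        Metric.cobounded_eq_cocompact]
      exact hF⟩).isClosedMap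

lemma coe_homeomorph (h : IsAccretiveMap U F B c)
    (hF : Tendsto (fun x => ‖F x‖) (cocompact E) atTop) : ⇑(h.homeomorph hF) = F := rfl

lemma eventually_norm_sub (h : IsAccretiveMap U F B c) (x : E) :
    ∀ᶠ r in nhdsWithin (0 : ℝ) (Ioi 0), ∀ a ∈ sphere x r,
      c / 2 * Real.exp (U x) * r ≤ ‖F a - F x‖ ∧
        ‖F a - F x‖ ≤ (B + c / 2) * Real.exp (U x) * r := by
  have h2 : 0 < c / 2 * Real.exp (U x) := by have := h.pos; positivity
  obtain ⟨ε, hε, hb⟩ := Metric.eventually_nhds_iff.1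
    ((h.differentiable x).hasFDerivAt.isLittleO.def h2)
  filter_upwards [Ioo_mem_nhdsGT hε] with r hr a ha
  have ha' : ‖a - x‖ = r := by rwa [← dist_eq_norm]
  have h3 := hb (y := a) (by rw [mem_sphere] at ha; rw [ha]; exact hr.2)
  have h4 := h.norm_fderiv_ge x (a - x)
  have h5 := h.norm_fderiv_le x (a - x)
  have h6 := norm_sub_norm_le (fderiv ℝ F x (a - x)) (F a - F x)
  have h7 := norm_sub_norm_le (F a - F x) (fderiv ℝ F x (a - x))
  rw [norm_sub_rev (fderiv ℝ F x (a - x)) (F a - F x)] at h6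
  rw [ha'] at h3 h4 h5
  constructor <;> linarith

end IsAccretiveMap

lemma exists_det_bounds (B : ℝ) (hc : 0 < c) : ∃ m : ℝ, 0 < m ∧ ∃ M : ℝ, ∀ N : E →L[ℝ] E,
    ‖N‖ ≤ B → (∀ w, c * ‖w‖ ^ 2 ≤ inner ℝ (N w) w) → m ≤ N.det ∧ N.det ≤ M := by
  set K : Set (E →L[ℝ] E) := closedBall 0 B ∩ ⋂ w, {N | c * ‖w‖ ^ 2 ≤ inner ℝ (N w) w} with hK
  have hKc : IsCompact K := by
    refine (isCompact_closedBall _ _).inter_right (isClosed_iInter fun w => ?_)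
    exact isClosed_le continuous_const (by fun_prop)
  have hmem : ∀ N : E →L[ℝ] E, N ∈ K ↔ ‖N‖ ≤ B ∧ ∀ w, c * ‖w‖ ^ 2 ≤ inner ℝ (N w) w := by
    intro N
    simp [hK]
  have hdet : Continuous fun N : E →L[ℝ] E => N.det := ContinuousLinearMap.continuous_det
  have hne : ∀ N : E →L[ℝ] E, ∀ b : ℝ, 0 < b → (∀ w, b * ‖w‖ ^ 2 ≤ inner ℝ (N w) w) →
      N.det ≠ 0 := by
    intro N b hb hN h0
    have h1 := LinearMap.bot_lt_ker_of_det_eq_zero (f := (N : E →ₗ[ℝ] E)) h0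
    obtain ⟨w, hw, hw0⟩ := (Submodule.ne_bot_iff _).1 h1.ne'
    have hw' : N w = 0 := hw
    have h2 := hN w
    rw [hw', inner_zero_left] at h2
    have := norm_pos_iff.2 hw0
    have : 0 < b * ‖w‖ ^ 2 := by positivity
    linarith
  have hpos : ∀ N ∈ K, 0 < N.det := by
    intro N hN
    by_contra hneg
    have hseg : ContinuousOn (fun t : ℝ => ((1 - t) • ContinuousLinearMap.id ℝ E + t • N).det)
        (Icc 0 1) := (hdet.comp (by fun_prop)).continuousOn
    obtain ⟨t, ht, ht0⟩ := intermediate_value_Icc' zero_le_one hseg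
      (show (0 : ℝ) ∈ _ by
        simpa [ContinuousLinearMap.det] using not_lt.1 hneg)
    refine hne _ (min 1 c) (lt_min one_pos hc) (fun w => ?_) ht0
    have h1 := ((hmem N).1 hN).2 w
    simp only [add_apply, smul_apply, ContinuousLinearMap.id_apply, inner_add_left,
      real_inner_smul_left, real_inner_self_eq_norm_sq]
    have h2 : min 1 c * ‖w‖ ^ 2 ≤ 1 * ‖w‖ ^ 2 := by gcongr; exact min_le_left _ _
    have h3 : min 1 c * ‖w‖ ^ 2 ≤ c * ‖w‖ ^ 2 := by gcongr; exact min_le_right _ _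
    nlinarith [ht.1, ht.2]
  obtain ⟨M, hM⟩ := hKc.exists_bound_of_continuousOn hdet.continuousOn
  rcases K.eq_empty_or_nonempty with h0 | h0
  · refine ⟨1, one_pos, 0, fun N h1 h2 => ?_⟩
    have : N ∈ K := (hmem N).2 ⟨h1, h2⟩
    simp [h0] at this
  · obtain ⟨N₀, hN₀, hmin⟩ := hKc.exists_isMinOn h0 hdet.continuousOn
    refine ⟨N₀.det, hpos N₀ hN₀, M, fun N h1 h2 => ?_⟩
    have : N ∈ K := (hmem N).2 ⟨h1, h2⟩
    exact ⟨hmin this, (le_abs_self _).trans (hM N this)⟩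

lemma IsAccretiveMap.quasiconformalWith {n : ℕ} [Nontrivial (Eu n)] {U : Eu n → ℝ}
    {F : Eu n → Eu n} (h : IsAccretiveMap U F B c) : QuasiconformalWith (2 * B / c + 1) F := by
  intro x
  have hc := h.pos
  have he := Real.exp_pos (U x)
  have hcob : IsCoboundedUnder (· ≤ ·) (nhdsWithin (0 : ℝ) (Ioi 0)) fun r => dilatQuot F x r := by
    refine isCoboundedUnder_le_of_eventually_le _ (x := 0) (Eventually.of_forall fun r => ?_)
    refine div_nonneg (Real.sSup_nonneg ?_) (Real.sInf_nonneg ?_) <;>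
    · rintro _ ⟨a, -, rfl⟩
      exact norm_nonneg _
  refine limsup_le_of_le hcob ?_
  filter_upwards [h.eventually_norm_sub x, self_mem_nhdsWithin] with r hr hr0
  have hr0' : 0 < r := hr0
  have hne : (sphere x r).Nonempty := NormedSpace.sphere_nonempty.2 hr0'.le
  have h1 : sSup ((fun a => ‖F a - F x‖) '' sphere x r) ≤ (B + c / 2) * Real.exp (U x) * r :=
    csSup_le (hne.image _) (by rintro _ ⟨a, ha, rfl⟩; exact (hr a ha).2)
  have h2 : c / 2 * Real.exp (U x) * r ≤ sInf ((fun b => ‖F b - F x‖) '' sphere x r) :=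
    le_csInf (hne.image _) (by rintro _ ⟨a, ha, rfl⟩; exact (hr a ha).1)
  have h3 : 0 < c / 2 * Real.exp (U x) * r := by positivity
  rw [dilatQuot, div_le_iff₀ (h3.trans_le h2)]
  have hB : 0 ≤ B := (norm_nonneg _).trans (h.norm_le x)
  refine h1.trans (le_trans (le_of_eq ?_) (mul_le_mul_of_nonneg_left h2 (by positivity)))
  field_simp

lemma IsAccretiveMap.exists_jacDet_bounds {n : ℕ} {u U : Eu n → ℝ} {F : Eu n → Eu n} {M : ℝ}
    (h : IsAccretiveMap U F B c) (hM : ∀ x, |u x - U x| ≤ M) :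
    ∃ C₁ : ℝ, 1 ≤ C₁ ∧ ∀ x, 0 < jacDet F x ∧ C₁⁻¹ * Real.exp ((n : ℝ) * u x) ≤ |jacDet F x| ∧
      |jacDet F x| ≤ C₁ * Real.exp ((n : ℝ) * u x) := by
  obtain ⟨m, hm, D, hD⟩ := exists_det_bounds (E := Eu n) B h.pos
  refine ⟨max 1 (max (D * Real.exp (n * M)) (m⁻¹ * Real.exp (n * M))), le_max_left _ _,
    fun x => ?_⟩
  set C₁ := max 1 (max (D * Real.exp (n * M)) (m⁻¹ * Real.exp (n * M))) with hC₁
  obtain ⟨h1, h2⟩ := hD _ (h.norm_le x) (h.inner_ge x)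
  set d := (Real.exp (-U x) • fderiv ℝ F x).det with hd
  have hdet : jacDet F x = Real.exp (n * U x) * d := by
    have : d = Real.exp (-U x) ^ n * jacDet F x := by
      rw [hd, jacDet, ContinuousLinearMap.det, ContinuousLinearMap.toLinearMap_smul,
        LinearMap.det_smul, finrank_euclideanSpace_fin]
    rw [this, ← Real.exp_nat_mul, ← mul_assoc, ← Real.exp_add]
    simp
  have hC0 : 0 < C₁ := one_pos.trans_le (le_max_left _ _)
  have hd0 : 0 < d := hm.trans_le h1
  have hux := abs_le.1 (hM x)
  have hn : (0 : ℝ) ≤ n := n.cast_nonneg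
  have hj : 0 < jacDet F x := by rw [hdet]; positivity
  refine ⟨hj, ?_, ?_⟩
  · rw [abs_of_pos hj, hdet, inv_mul_le_iff₀ hC0]
    have h3 : m⁻¹ * Real.exp (n * M) ≤ C₁ := (le_max_right _ _).trans (le_max_right _ _)
    calc Real.exp (n * u x) ≤ Real.exp (n * M + n * U x) :=
          Real.exp_le_exp.2 (by nlinarith [mul_le_mul_of_nonneg_left hux.2 hn])
      _ = m⁻¹ * Real.exp (n * M) * (Real.exp (n * U x) * m) := by
          rw [Real.exp_add]; field_simp
      _ ≤ C₁ * (Real.exp (n * U x) * d) := by gcongr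
  · rw [abs_of_pos hj, hdet]
    have h3 : D * Real.exp (n * M) ≤ C₁ := (le_max_left _ _).trans (le_max_right _ _)
    calc Real.exp (n * U x) * d ≤ Real.exp (n * M + n * u x) * D := by
          gcongr
          nlinarith [mul_le_mul_of_nonneg_left hux.1 hn]
      _ = D * Real.exp (n * M) * Real.exp (n * u x) := by rw [Real.exp_add]; ring
      _ ≤ _ := by gcongr

end Conclusion

section Main

variable {E : Type*} [NormedAddCommGroup E] [InnerProductSpace ℝ E] [FiniteDimensional ℝ E]
  [MeasurableSpace E] [BorelSpace E] {μ : Measure E} {ρ₀ : E → ℝ}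

lemma integral_abs_indicator (R : ℝ) : ∫ y, |(closedBall 0 R)ᶜ.indicator ρ₀ y| ∂μ =
    ∫ y in (closedBall 0 R)ᶜ, |ρ₀ y| ∂μ := by
  rw [← integral_indicator measurableSet_closedBall.compl]
  exact integral_congr_ae (Eventually.of_forall fun y => norm_indicator_eq_indicator_norm ρ₀ y)

lemma exists_integral_tail_le (hi : Integrable ρ₀ μ) {δ : ℝ} (hδ : 0 < δ) :
    ∃ R : ℝ, 1 ≤ R ∧ ∫ y, |(closedBall 0 R)ᶜ.indicator ρ₀ y| ∂μ ≤ δ := by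
  have hs : Antitone fun k : ℕ => (closedBall (0 : E) k)ᶜ := fun i j hij =>
    compl_subset_compl.2 (closedBall_subset_closedBall (Nat.cast_le.2 hij))
  have hlim := tendsto_setIntegral_of_antitone (μ := μ) (f := fun y => |ρ₀ y|)
    (fun k : ℕ => (measurableSet_closedBall (x := (0 : E)) (ε := (k : ℝ))).compl) hs
    ⟨0, hi.abs.integrableOn⟩
  rw [← compl_iUnion, iUnion_closedBall_nat, compl_univ, setIntegral_empty] at hlim
  obtain ⟨k, hk, hk1⟩ := ((hlim.eventually_le_const hδ).and (eventually_ge_atTop 1)).exists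
  refine ⟨k, by exact_mod_cast hk1, ?_⟩
  rwa [integral_abs_indicator]

lemma integral_closedBall_add_tail (hi : Integrable ρ₀ μ) (R : ℝ) :
    (∫ y in closedBall 0 R, ρ₀ y ∂μ) + ∫ y, (closedBall 0 R)ᶜ.indicator ρ₀ y ∂μ = ∫ y, ρ₀ y ∂μ := by
  rw [integral_indicator measurableSet_closedBall.compl,
    integral_add_compl measurableSet_closedBall hi]

/-- The logarithmic potential of a density of total mass less than `1` is, up to a bounded error,
the logarithm of the conformal factor of a proper accretive map. -/
theorem exists_isAccretiveMap [Nontrivial E] [μ.IsAddHaarMeasure] (hc : Continuous ρ₀)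
    (hi : Integrable ρ₀ μ) (hw : Continuous fun x => ∫ y, Real.log (‖y‖ / ‖x - y‖) * ρ₀ y ∂μ)
    (hlt : ∫ y, ρ₀ y ∂μ < 1) :
    ∃ (U : E → ℝ) (F : E → E) (B c : ℝ), IsAccretiveMap U F B c ∧
      Tendsto (fun x => ‖F x‖) (cocompact E) atTop ∧
      ∃ M : ℝ, ∀ x, |(∫ y, Real.log (‖y‖ / ‖x - y‖) * ρ₀ y ∂μ) - U x| ≤ M := by
  obtain ⟨G, hG, hslope⟩ := exists_bound_expSlope
  set T := ∫ y, |ρ₀ y| ∂μ with hT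
  have hT0 : 0 ≤ T := integral_nonneg fun _ => abs_nonneg _
  set L := 64 * (G * flowLip T (1 + T)) with hL
  have hL1 : 0 < L := by
    have : 0 < flowLip T (1 + T) := by unfold flowLip; positivity
    positivity
  set c₀ := (1 - max (∫ y, ρ₀ y ∂μ) 0) / 2 with hc₀
  have hc₀pos : 0 < c₀ := by
    have : max (∫ y, ρ₀ y ∂μ) 0 < 1 := max_lt hlt one_pos
    linarith
  obtain ⟨R, hR, htail⟩ := exists_integral_tail_le hi
    (δ := min (min (1 / 4) (c₀ / 2)) (min 1 (c₀ / 2) / L)) (by positivity)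
  set σ := (closedBall 0 R)ᶜ.indicator ρ₀ with hσdef
  set a := ∫ y in closedBall 0 R, ρ₀ y ∂μ with ha
  have hσ : IsTailDensity μ σ := isTailDensity_indicator hc hi hR
  have hρ := hσ.const_mul (Real.log 2)
  obtain ⟨⟨h1, h2⟩, h3⟩ := (le_min_iff.1 htail).imp le_min_iff.1 id
  have hρle : ∫ y, |Real.log 2 * σ y| ∂μ ≤ ∫ y, |σ y| ∂μ := by
    refine integral_mono hρ.integrable.abs hσ.integrable.abs fun y => ?_
    have hl2 := Real.log_two_lt_d9
    rw [abs_mul, abs_of_pos (Real.log_pos one_lt_two)]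
    exact mul_le_of_le_one_left (abs_nonneg _) (by linarith)
  have hLρ : L * ∫ y, |Real.log 2 * σ y| ∂μ ≤ min 1 (c₀ / 2) := by
    rw [le_div_iff₀ hL1] at h3
    nlinarith
  have haT : |a| + ∫ y, |σ y| ∂μ ≤ T := by
    rw [hT, ← integral_add_compl (measurableSet_closedBall (x := (0 : E)) (ε := R)) hi.abs,
      hσdef, integral_abs_indicator]
    gcongr
    exact abs_integral_le_integral_abs
  have hmax : max a 0 + ∫ y, |σ y| ∂μ ≤ 1 - c₀ := by
    have h4 := integral_closedBall_add_tail hi R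
    have h5 : -(∫ y, σ y ∂μ) ≤ ∫ y, |σ y| ∂μ := (neg_le_abs _).trans abs_integral_le_integral_abs
    have h6 : max a 0 ≤ max (∫ y, ρ₀ y ∂μ) 0 + ∫ y, |σ y| ∂μ := by
      refine max_le ?_ (add_nonneg (le_max_right _ _) (integral_nonneg fun _ => abs_nonneg _))
      have := le_max_left (∫ y, ρ₀ y ∂μ) 0
      linarith
    linarith
  have hstart := hσ.isFlowStart a haT
  have hdata : IsFlowData μ (fun y => Real.log 2 * σ y) (initPot μ σ a) (initMap μ σ a) T (1 + T)
      G := ⟨hstart, hρ, hG, hslope, hρle.trans h1, hLρ.trans (min_le_left _ _)⟩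
  refine ⟨limitPot μ (fun y => Real.log 2 * σ y) (initPot μ σ a),
    limitMap μ (fun y => Real.log 2 * σ y) (initMap μ σ a), 1 + T + 1, c₀ / 2,
    ⟨hdata.differentiable_limitMap, half_pos hc₀pos, fun x => ?_, fun x w => ?_⟩, ?_,
    exists_abs_potential_sub_le hc hi hR hw⟩
  · have h4 := hdata.norm_fderiv_limitMap_sub_le x
    have h5 := hstart.norm_fderiv_map x
    have h6 := hLρ.trans (min_le_left _ _)
    exact (norm_le_norm_add_norm_sub' _ _).trans (add_le_add h5 (h4.trans h6))
  · have h4 := (hdata.norm_fderiv_limitMap_sub_le x).trans (hLρ.trans (min_le_right _ _))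
    have h5 := hσ.inner_normalized_fderiv_initMap a x w
    set N := Real.exp (-limitPot μ (fun y => Real.log 2 * σ y) (initPot μ σ a) x) •
      fderiv ℝ (limitMap μ (fun y => Real.log 2 * σ y) (initMap μ σ a)) x
    set N₀ := Real.exp (-initPot μ σ a x) • fderiv ℝ (initMap μ σ a) x
    have h6 : |inner ℝ ((N - N₀) w) w| ≤ c₀ / 2 * ‖w‖ ^ 2 := by
      refine (abs_real_inner_le_norm _ _).trans ?_
      rw [sq, ← mul_assoc]
      gcongr
      exact (N - N₀).le_of_opNorm_le h4 w
    rw [sub_apply, inner_sub_left] at h6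
    have h7 := (abs_le.1 h6).1
    have h8 : c₀ * ‖w‖ ^ 2 ≤ (1 - (max a 0 + ∫ y, |σ y| ∂μ)) * ‖w‖ ^ 2 := by
      gcongr
      linarith
    linarith
  · refine tendsto_atTop_mono (fun x => ?_)
      ((hσ.tendsto_norm_initMap (a := a) (by linarith)).const_mul_atTop (one_half_pos (α := ℝ)))
    have h4 := hdata.norm_limitMap_sub_le x
    have h5 := norm_le_norm_add_norm_sub
      (limitMap μ (fun y => Real.log 2 * σ y) (initMap μ σ a) x) (initMap μ σ a x)
    linarith

lemma integrable_log_kernel_mul [Nontrivial E] [μ.IsAddHaarMeasure] (hc : Continuous ρ₀)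
    (hi : Integrable ρ₀ μ) (x : E) :
    Integrable (fun y => Real.log (‖y‖ / ‖x - y‖) * ρ₀ y) μ := by
  set r := 2 * ‖x‖ + 1 with hr
  have hl : IntegrableOn (fun y : E => Real.log ‖y‖) (closedBall 0 r) μ :=
    (integrableOn_log_norm (r + 1)).mono_set (closedBall_subset_ball (lt_add_one r))
  have hl' : IntegrableOn (fun y : E => Real.log ‖x - y‖) (closedBall 0 r) μ := by
    have h1 : Integrable ((ball (0 : E) (r + ‖x‖ + 1)).indicator fun y => Real.log ‖y‖) μ :=
      (integrableOn_log_norm (r + ‖x‖ + 1)).integrable_indicator measurableSet_ball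
    refine ((h1.comp_sub_left x).integrableOn (s := closedBall 0 r)).congr_fun (fun y hy => ?_)
      measurableSet_closedBall
    refine indicator_of_mem ?_ _
    have h2 : ‖y‖ ≤ r := by simpa using hy
    have h3 := norm_sub_le x y
    rw [mem_ball_zero_iff]
    linarith
  have hnear : IntegrableOn (fun y => Real.log (‖y‖ / ‖x - y‖) * ρ₀ y) (closedBall 0 r) μ := by
    refine IntegrableOn.mul_continuousOn ?_ hc.continuousOn (isCompact_closedBall _ _)
    refine Integrable.congr (hl.sub hl') (ae_restrict_of_ae ?_)
    filter_upwards [ae_ne x, ae_ne (μ := μ) (0 : E)] with y hxy hy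
    exact (Real.log_div (norm_ne_zero_iff.2 hy.symm) (norm_ne_zero_iff.2 (sub_ne_zero.2 hxy))).symm
  have hm : Measurable fun y : E => Real.log (‖y‖ / ‖x - y‖) := by fun_prop
  have hfar : IntegrableOn (fun y => Real.log (‖y‖ / ‖x - y‖) * ρ₀ y) (closedBall 0 r)ᶜ μ := by
    refine hi.integrableOn.bdd_mul (c := 1) hm.aestronglyMeasurable ?_
    refine (ae_restrict_iff' measurableSet_closedBall.compl).2 (Eventually.of_forall fun y hy => ?_)
    have hy' : r < ‖y‖ := by simpa using hy
    have hx0 := norm_nonneg x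
    have h2 := norm_sub_le x y
    have h3 := norm_sub_norm_le y x
    rw [norm_sub_rev] at h3
    have hd : 0 < ‖x - y‖ := by linarith
    have hl2 := Real.log_two_lt_d9
    have hq : 0 < ‖y‖ / ‖x - y‖ := div_pos (by linarith) hd
    rw [Real.norm_eq_abs, abs_le]
    constructor
    · have h4 : Real.log (2 : ℝ)⁻¹ ≤ Real.log (‖y‖ / ‖x - y‖) := by
        refine Real.log_le_log (by norm_num) ?_
        rw [le_div_iff₀ hd]
        linarith
      rw [Real.log_inv] at h4
      linarith
    · have h4 : Real.log (‖y‖ / ‖x - y‖) ≤ Real.log 2 := by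
        refine Real.log_le_log hq ?_
        rw [div_le_iff₀ hd]
        linarith
      linarith
  rw [← integrableOn_univ, ← union_compl_self (closedBall (0 : E) r)]
  exact hnear.union hfar

end Main

lemma contDiff_lapIter {n : ℕ} {u : Eu n → ℝ} (hu : ContDiff ℝ (⊤ : ℕ∞) u) (k : ℕ) :
    ContDiff ℝ (⊤ : ℕ∞) (lapIter k u) := by
  induction k with
  | zero => exact hu
  | succ k ih =>
    have h : ContDiff ℝ (⊤ : ℕ∞) (iteratedFDeriv ℝ 2 (lapIter k u)) :=
      ih.iteratedFDeriv_right (by norm_cast)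
    change ContDiff ℝ (⊤ : ℕ∞) fun x => ∑ i : Fin n, iteratedFDeriv ℝ 2 (lapIter k u) x
      ![EuclideanSpace.single i 1, EuclideanSpace.single i 1]
    refine ContDiff.sum fun i _ => ?_
    exact (ContinuousMultilinearMap.apply ℝ (fun _ : Fin 2 => Eu n) ℝ
      ![EuclideanSpace.single i 1, EuclideanSpace.single i 1]).contDiff.comp h

lemma lapIter_zero {n : ℕ} (k : ℕ) : lapIter k (0 : Eu n → ℝ) = 0 := by
  induction k with
  | zero => rfl
  | succ k ih =>
    ext x
    simp [lapIter, ih, lap]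

/-- A metric `e^{2u}|dx|²` whose conformal factor is, up to an additive constant, the logarithmic
potential of an integrable density of total mass less than `1` has a quasiconformal
parametrization with Jacobian comparable to `e^{nu}`. -/
theorem quasiconformal_of_log_potential {n : ℕ} (hn : 4 ≤ n) {u f : Eu n → ℝ} (hu : Continuous u)
    (hfc : Continuous f) (hfL1 : Integrable f) {κ C : ℝ}
    (hnormal : ∀ x : Eu n, u x = κ * (∫ y, Real.log (‖y‖ / ‖x - y‖) * f y) + C)
    (hlt : κ * ∫ x, f x < 1) :
    ∃ H : ℝ, 1 ≤ H ∧ ∃ F : Eu n ≃ₜ Eu n, QuasiconformalWith H F ∧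
      ∃ C₁ : ℝ, 1 ≤ C₁ ∧
        ∀ᵐ x ∂(volume : Measure (Eu n)),
          DifferentiableAt ℝ (⇑F) x ∧ 0 < jacDet (⇑F) x ∧
            C₁⁻¹ * Real.exp ((n : ℝ) * u x) ≤ |jacDet (⇑F) x| ∧
            |jacDet (⇑F) x| ≤ C₁ * Real.exp ((n : ℝ) * u x) := by
  have : NeZero n := ⟨by omega⟩
  have hpot : (fun x : Eu n => ∫ y, Real.log (‖y‖ / ‖x - y‖) * (κ * f y)) = fun x => u x - C := by
    ext x
    rw [hnormal x, add_sub_cancel_right, ← integral_const_mul]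
    congr 1
    ext y
    ring
  obtain ⟨U, F, B, c, hF, hlim, M, hM⟩ := exists_isAccretiveMap (μ := (volume : Measure (Eu n)))
    (ρ₀ := fun y => κ * f y) (by fun_prop) (hfL1.const_mul κ)
    (by rw [hpot]; fun_prop) (by rwa [integral_const_mul])
  have hM' : ∀ x, |u x - U x| ≤ M + |C| := fun x => by
    have h1 := hM x
    rw [congrFun hpot x] at h1
    have h2 := abs_add_le (u x - C - U x) C
    rw [show u x - C - U x + C = u x - U x by ring] at h2
    linarith
  obtain ⟨C₁, hC₁, hj⟩ := hF.exists_jacDet_bounds hM'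
  have hB : 0 ≤ B := (norm_nonneg _).trans (hF.norm_le 0)
  have hc := hF.pos
  refine ⟨2 * B / c + 1, by linarith [show 0 ≤ 2 * B / c by positivity], hF.homeomorph hlim, ?_,
    C₁, hC₁, Eventually.of_forall fun x => ?_⟩
  · rw [hF.coe_homeomorph]
    exact hF.quasiconformalWith
  · rw [hF.coe_homeomorph]
    exact ⟨hF.differentiable x, hj x⟩

/-- **Quasiconformal equivalence (Wang).** If `e^{2u}|dx|²` is complete, normal,
`f = (-Δ)^{n/2}u` is integrable and `(1/(2cₙ)) ∫ f < 1`, then there is an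
`H`-quasiconformal orientation-preserving homeomorphism `F : ℝⁿ → ℝⁿ`, differentiable
almost everywhere, whose Jacobian is comparable to `e^{nu}`. -/
theorem quasiconformal_of_normal_metric
    (n : ℕ) (hn : 4 ≤ n) (hev : Even n)
    (u : Eu n → ℝ) (hu : ContDiff ℝ (⊤ : ℕ∞) u)
    (f : Eu n → ℝ) (hf : ∀ x, f x = (-1 : ℝ) ^ (n / 2) * lapIter (n / 2) u x)
    (hcomplete : ConfComplete u)
    (hfL1 : Integrable f)
    (hnormal : ∃ C : ℝ, ∀ x : Eu n,
      u x = (1 / (2 * cQ n)) * ∫ y, Real.log (‖y‖ / ‖x - y‖) * f y + C)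
    (hlt : (1 / (2 * cQ n)) * ∫ x, f x < 1) :
    ∃ H : ℝ, 1 ≤ H ∧ ∃ F : Eu n ≃ₜ Eu n, QuasiconformalWith H F ∧
      ∃ C₁ : ℝ, 1 ≤ C₁ ∧
        ∀ᵐ x ∂(volume : Measure (Eu n)),
          DifferentiableAt ℝ (⇑F) x ∧ 0 < jacDet (⇑F) x ∧
            C₁⁻¹ * Real.exp ((n : ℝ) * u x) ≤ |jacDet (⇑F) x| ∧
            |jacDet (⇑F) x| ≤ C₁ * Real.exp ((n : ℝ) * u x) := by
  have : NeZero n := ⟨by omega⟩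
  obtain ⟨C, hC⟩ := hnormal
  have hfc : Continuous f := by
    rw [funext hf]
    exact continuous_const.mul (contDiff_lapIter hu _).continuous
  rcases eq_or_ne C 0 with rfl | hC0
  · exact quasiconformal_of_log_potential hn hu.continuous hfc hfL1 (C := 0)
      (fun x => by simpa using hC x) hlt
  · have hu0 : u = 0 := by
      ext x
      have hni : ¬ Integrable fun y => Real.log (‖y‖ / ‖x - y‖) * f y + C := fun h => by
        have h1 := h.sub (integrable_log_kernel_mul hfc hfL1 x)
        have h2 : Integrable (fun _ : Eu n => C) :=
          h1.congr (Eventually.of_forall fun y => by simp)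
        rcases integrable_const_iff.1 h2 with h3 | h3
        · exact hC0 h3
        · exact (measure_lt_top (volume : Measure (Eu n)) univ).ne
            (measure_univ_of_isAddLeftInvariant _)
      rw [hC x, integral_undef hni, mul_zero, Pi.zero_apply]
    have hf0 : ∀ x, f x = 0 := fun x => by simp [hf x, hu0, lapIter_zero]
    exact quasiconformal_of_log_potential hn hu.continuous hfc hfL1 (κ := 1 / (2 * cQ n)) (C := 0)
      (fun x => by simp [hf0, hu0]) hlt
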